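/- arXiv:2510.25746 — 16 statements merged into one kernel-verified Lean document; each statement's English description precedes it below -/
import Mathlib

section
/- For all real ε > 0 and all real α > 1, (1/(α−1)) · log( (α·exp((α−1)·ε) + (α−1)·exp(−α·ε)) / (2α−1) ) ≤ α·(ε + exp(−ε) − 1). (This states that the ε-DP Laplace mechanism, whose tight Rényi divergence of order α equals the left-hand side divided by α... i.e. whose tight (α, ε̂_L(α))-RDP curve is ε̂_L(α) = (1/(α−1))·log( (α/(2α−1))·e^{(α−1)ε} + ((α−1)/(2α−1))·e^{−αε} ), satisfies (ε + e^{−ε} − 1)-zCDP.) -/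
theorem nonneg_of_hasDerivAt_nonneg {f f' : ℝ → ℝ} (h0 : f 0 = 0)
    (hf : ∀ x, HasDerivAt f (f' x) x) (hf' : ∀ x, 0 < x → 0 ≤ f' x) {x : ℝ} (hx : 0 ≤ x) :
    0 ≤ f x := by
  have hmono : MonotoneOn f (Set.Ici 0) := by
    refine monotoneOn_of_deriv_nonneg (convex_Ici 0)
      (fun y _ => (hf y).continuousAt.continuousWithinAt)
      (fun y _ => (hf y).differentiableAt.differentiableWithinAt) fun y hy => ?_
    rw [interior_Ici] at hy
    rw [(hf y).deriv]
    exact hf' y hy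
  simpa [h0] using hmono Set.self_mem_Ici hx hx

theorem hasDerivAt_exp_const_mul (c x : ℝ) :
    HasDerivAt (fun y => Real.exp (c * y)) (c * Real.exp (c * x)) x := by
  simpa [mul_comm] using ((hasDerivAt_id x).const_mul c).exp

/-- Bernoulli's inequality at the point `exp s`. -/
theorem one_add_mul_exp_sub_one_le_exp_mul {b : ℝ} (hb : 1 ≤ b) (s : ℝ) :
    1 + b * (Real.exp s - 1) ≤ Real.exp (b * s) := by
  have h := one_add_mul_self_le_rpow_one_add (s := Real.exp s - 1)
    (by linarith [Real.exp_pos s]) hb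
  rwa [add_sub_cancel, ← Real.exp_mul, mul_comm s b] at h

theorem laplace_exp_combination_nonneg {α : ℝ} (hα : 1 < α) {s : ℝ} (hs : 0 ≤ s) :
    0 ≤ (α - 1) - α * Real.exp (-1 * s) + α * Real.exp (-(2 * α - 1) * s)
      - (α - 1) * Real.exp (-(2 * α) * s) := by
  refine nonneg_of_hasDerivAt_nonneg
    (f := fun s => (α - 1) - α * Real.exp (-1 * s) + α * Real.exp (-(2 * α - 1) * s)
      - (α - 1) * Real.exp (-(2 * α) * s))
    (by simp only [mul_zero, Real.exp_zero]; ring)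
    (fun x => ((((hasDerivAt_exp_const_mul (-1) x).const_mul α).const_sub (α - 1)).add
      ((hasDerivAt_exp_const_mul (-(2 * α - 1)) x).const_mul α)).sub
      ((hasDerivAt_exp_const_mul (-(2 * α)) x).const_mul (α - 1)))
    (fun x _ => ?_) hs
  have hB := one_add_mul_exp_sub_one_le_exp_mul (b := 2 * α - 1) (by linarith) x
  have h1 : Real.exp (-1 * x) = Real.exp (-(2 * α) * x) * Real.exp ((2 * α - 1) * x) := by
    rw [← Real.exp_add]; ring_nf
  have h2 : Real.exp (-(2 * α - 1) * x) = Real.exp (-(2 * α) * x) * Real.exp x := by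
    rw [← Real.exp_add]; ring_nf
  rw [h1, h2]
  have h : 0 ≤ α * Real.exp (-(2 * α) * x) *
      (Real.exp ((2 * α - 1) * x) - (1 + (2 * α - 1) * (Real.exp x - 1))) :=
    mul_nonneg (by positivity) (by linarith)
  linarith

/-- The ε-DP Laplace mechanism, with tight RDP curve
`ε̂_L(α) = (1/(α−1))·log((α·e^{(α−1)ε} + (α−1)·e^{−αε})/(2α−1))`,
satisfies `(ε + e^{−ε} − 1)`-zCDP. -/
theorem laplace_zCDP (ε : ℝ) (hε : 0 < ε) (α : ℝ) (hα : 1 < α) :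
    (1 / (α - 1)) *
      Real.log ((α * Real.exp ((α - 1) * ε) + (α - 1) * Real.exp (-α * ε)) / (2 * α - 1))
      ≤ α * (ε + Real.exp (-ε) - 1) := by
  have ha : 0 < α - 1 := by linarith
  have hb : 0 < 2 * α - 1 := by linarith
  have hpos (x : ℝ) : 0 < α * Real.exp ((α - 1) * x) + (α - 1) * Real.exp (-α * x) := by
    positivity
  have key : 0 ≤ α * (α - 1) * (ε + Real.exp (-1 * ε) - 1) -
      Real.log ((α * Real.exp ((α - 1) * ε) + (α - 1) * Real.exp (-α * ε)) / (2 * α - 1)) := by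
    refine nonneg_of_hasDerivAt_nonneg
      (f := fun x => α * (α - 1) * (x + Real.exp (-1 * x) - 1) -
        Real.log ((α * Real.exp ((α - 1) * x) + (α - 1) * Real.exp (-α * x)) / (2 * α - 1)))
      ?_
      (fun x => ((((hasDerivAt_id x).add (hasDerivAt_exp_const_mul (-1) x)).sub_const 1).const_mul
        (α * (α - 1))).sub
        (((((hasDerivAt_exp_const_mul (α - 1) x).const_mul α).add
          ((hasDerivAt_exp_const_mul (-α) x).const_mul (α - 1))).div_const (2 * α - 1)).log
          (div_pos (hpos x) hb).ne'))
      (fun x hx => ?_) hε.le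
    · have h : (α + (α - 1)) / (2 * α - 1) = 1 := by
        rw [div_eq_one_iff_eq hb.ne']; ring
      simp [h]
    · have hφ := laplace_exp_combination_nonneg hα hx.le
      have h1 : Real.exp (-α * x) =
          Real.exp ((α - 1) * x) * Real.exp (-(2 * α - 1) * x) := by
        rw [← Real.exp_add]; ring_nf
      have h2 : Real.exp (-(2 * α) * x) =
          Real.exp (-1 * x) * Real.exp (-(2 * α - 1) * x) := by
        rw [← Real.exp_add]; ring_nf
      have hp := hpos x
      simp only [Pi.add_apply]
      rw [div_div_div_cancel_right₀ hb.ne', sub_nonneg, div_le_iff₀ hp, h1]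
      rw [h2] at hφ
      have h := mul_nonneg
        (by positivity : 0 ≤ α * (α - 1) * Real.exp ((α - 1) * x)) hφ
      linarith
  rw [neg_one_mul] at key
  rw [one_div, inv_mul_le_iff₀ ha]
  linarith
end

section
/- For all real ε > 0, the limit as α → 1⁺ of (1/(α−1)) · log( (α·exp((α−1)·ε) + (α−1)·exp(−α·ε)) / (2α−1) ) equals ε + exp(−ε) − 1. -/
open Filter

/-- The logarithm of the Rényi moment of the Laplace mechanism has derivative
`ε + e^{−ε} − 1` at order `1`. -/
theorem hasDerivAt_log_laplace_moment (ε : ℝ) :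
    HasDerivAt (fun α : ℝ =>
        Real.log ((α * Real.exp ((α - 1) * ε) + (α - 1) * Real.exp (-α * ε)) / (2 * α - 1)))
      (ε + Real.exp (-ε) - 1) 1 := by
  have hid := hasDerivAt_id' (1 : ℝ)
  have hpos := hid.mul (((hid.sub_const 1).mul_const ε).exp)
  have hneg := (hid.sub_const 1).mul ((hid.neg.mul_const ε).exp)
  have hden := (hid.const_mul 2).sub_const 1
  have h := ((hpos.add hneg).div hden (by norm_num)).log (by simp; norm_num)
  refine h.congr_deriv ?_
  have h_one : (2 : ℝ) - 1 = 1 := by norm_num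
  simp only [Pi.add_apply, Pi.mul_apply, Pi.div_apply, Pi.neg_apply]
  simp [h_one]
  ring

/-- The limit as α → 1⁺ of the tight RDP curve of the ε-DP Laplace mechanism
equals ε + e^{−ε} − 1. -/
theorem laplace_rdp_limit (ε : ℝ) (hε : 0 < ε) :
    Tendsto (fun α : ℝ =>
        (1 / (α - 1)) *
          Real.log ((α * Real.exp ((α - 1) * ε) + (α - 1) * Real.exp (-α * ε)) / (2 * α - 1)))
      (nhdsWithin 1 (Set.Ioi 1)) (nhds (ε + Real.exp (-ε) - 1)) := by
  have h := (hasDerivAt_log_laplace_moment ε).tendsto_slope.mono_left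
    (nhdsWithin_mono 1 fun _ hx => ne_of_gt hx)
  refine h.congr fun α => ?_
  have h_one : (2 : ℝ) - 1 = 1 := by norm_num
  simp [slope_def_field, h_one, div_eq_inv_mul]
end

section
/- For all real a > 0, every natural number d ≥ 0, and all real α > 1, the sum over all integers x of exp(−a·(α·|x−d| + (1−α)·|x|)) equals exp(−a·α·d)/(exp(a)−1) + (exp(a − a·α·d) − exp(a·(α·(d+2) − d)))/(exp(a) − exp(2·a·α)) + exp(a·(α−1)·d)/(exp(a)−1). -/
/-- The geometric series `∑ c * exp (-a * (n + 1))` over the naturals. -/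
lemma hasSum_const_mul_exp_neg_mul_succ (a c : ℝ) (ha : 0 < a) :
    HasSum (fun n : ℕ => c * Real.exp (-a * ((n : ℝ) + 1))) (c / (Real.exp a - 1)) := by
  have hlt : Real.exp (-a) < 1 := Real.exp_lt_one_iff.mpr (neg_lt_zero.mpr ha)
  have hgt : 1 < Real.exp a := Real.one_lt_exp_iff.mpr ha
  have h := (hasSum_geometric_of_lt_one (Real.exp_pos (-a)).le hlt).mul_left (c * Real.exp (-a))
  convert! h using 1
  · funext n
    rw [← Real.exp_nat_mul, mul_assoc, ← Real.exp_add]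
    congr 2
    ring
  · rw [Real.exp_neg] at hlt ⊢
    have h₀ : Real.exp a ≠ 0 := (Real.exp_pos a).ne'
    have h₁ : Real.exp a - 1 ≠ 0 := by linarith
    have h₂ : 1 - (Real.exp a)⁻¹ ≠ 0 := by linarith
    field_simp

/-- The finite geometric sum over the integers between `0` and the shift `d`. -/
lemma sum_range_exp_shift (a : ℝ) (ha : 0 < a) (d : ℕ) (α : ℝ) (hα : 1 < α) :
    ∑ n ∈ Finset.range (d + 1), Real.exp (-a * (α * ((d : ℝ) - n) + (1 - α) * n))
      = (Real.exp (a - a * α * d) - Real.exp (a * (α * (d + 2) - d)))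
          / (Real.exp a - Real.exp (2 * a * α)) := by
  have hden : Real.exp a - Real.exp (2 * a * α) ≠ 0 := by
    have : Real.exp a < Real.exp (2 * a * α) := Real.exp_lt_exp.mpr (by nlinarith)
    linarith
  have hterm : ∀ n : ℕ, Real.exp (-a * (α * ((d : ℝ) - n) + (1 - α) * n))
      = Real.exp (-a * α * d) * Real.exp (a * (2 * α - 1)) ^ n := fun n => by
    rw [← Real.exp_nat_mul, ← Real.exp_add]
    congr 1
    ring
  have hq : Real.exp (2 * a * α) = Real.exp a * Real.exp (a * (2 * α - 1)) := by
    rw [← Real.exp_add]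
    congr 1
    ring
  have hfirst : Real.exp (a - a * α * d) = Real.exp a * Real.exp (-a * α * d) := by
    rw [← Real.exp_add]
    congr 1
    ring
  have hlast : Real.exp (a * (α * (d + 2) - d))
      = Real.exp a * Real.exp (-a * α * d) * Real.exp (a * (2 * α - 1)) ^ (d + 1) := by
    rw [← Real.exp_nat_mul, ← Real.exp_add, ← Real.exp_add]
    congr 1
    push_cast
    ring
  simp_rw [hterm]
  rw [← Finset.mul_sum, eq_div_iff hden, hq, hfirst, hlast]
  linear_combination (-Real.exp a * Real.exp (-a * α * d))
    * geom_sum_mul (Real.exp (a * (2 * α - 1))) (d + 1)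

/-- Closed form for the sum arising in the Rényi divergence of the discrete
Laplace distribution and its shift by `d`. -/
theorem discrete_laplace_renyi_sum (a : ℝ) (ha : 0 < a) (d : ℕ) (α : ℝ) (hα : 1 < α) :
    (∑' x : ℤ, Real.exp (-a * (α * |(x : ℝ) - (d : ℝ)| + (1 - α) * |(x : ℝ)|)))
      = Real.exp (-a * α * d) / (Real.exp a - 1)
        + (Real.exp (a - a * α * d) - Real.exp (a * (α * (d + 2) - d)))
            / (Real.exp a - Real.exp (2 * a * α))
        + Real.exp (a * (α - 1) * d) / (Real.exp a - 1) := by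
  set f : ℤ → ℝ := fun x =>
    Real.exp (-a * (α * |(x : ℝ) - (d : ℝ)| + (1 - α) * |(x : ℝ)|)) with hf
  have hneg : HasSum (fun n : ℕ => f (-(n + 1 : ℤ)))
      (Real.exp (-a * α * d) / (Real.exp a - 1)) := by
    convert hasSum_const_mul_exp_neg_mul_succ a (Real.exp (-a * α * d)) ha using 1
    funext n
    have hn : (0 : ℝ) ≤ n := n.cast_nonneg
    have hd : (0 : ℝ) ≤ d := d.cast_nonneg
    simp only [hf]
    push_cast
    rw [abs_of_nonpos (by linarith), abs_of_nonpos (by linarith), ← Real.exp_add]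
    congr 1
    ring
  have htail : HasSum (fun n : ℕ => f ((n + (d + 1) : ℕ) : ℤ))
      (Real.exp (a * (α - 1) * d) / (Real.exp a - 1)) := by
    convert hasSum_const_mul_exp_neg_mul_succ a (Real.exp (a * (α - 1) * d)) ha using 1
    funext n
    have hn : (0 : ℝ) ≤ n := n.cast_nonneg
    have hd : (0 : ℝ) ≤ d := d.cast_nonneg
    simp only [hf]
    push_cast
    rw [abs_of_nonneg (by linarith), abs_of_nonneg (by linarith), ← Real.exp_add]
    congr 1
    ring
  have hmid : ∑ n ∈ Finset.range (d + 1), f (n : ℤ)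
      = (Real.exp (a - a * α * d) - Real.exp (a * (α * (d + 2) - d)))
          / (Real.exp a - Real.exp (2 * a * α)) := by
    rw [← sum_range_exp_shift a ha d α hα]
    refine Finset.sum_congr rfl fun n hn => ?_
    have hnd : (n : ℝ) ≤ d := by
      exact_mod_cast Nat.lt_succ_iff.mp (Finset.mem_range.mp hn)
    simp only [hf, Int.cast_natCast]
    rw [abs_of_nonpos (by linarith), abs_of_nonneg n.cast_nonneg, neg_sub]
  have hnat := (hasSum_nat_add_iff (f := fun n : ℕ => f n) (d + 1)).mp htail
  rw [(hnat.of_nat_of_neg_add_one hneg).tsum_eq, hmid]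
  ring
end

section
/- For all real a > 0 and all real α > 1, the function f(d) = exp(−a·α·d)/(exp(a)−1) + (exp(a − a·α·d) − exp(a·(α·(d+2) − d)))/(exp(a) − exp(2·a·α)) + exp(a·(α−1)·d)/(exp(a)−1) is monotone increasing in d on [0, ∞). -/
theorem convexOn_sinh_Ici : ConvexOn ℝ (Set.Ici 0) Real.sinh := by
  refine MonotoneOn.convexOn_of_deriv (convex_Ici 0) Real.continuous_sinh.continuousOn
    Real.differentiable_sinh.differentiableOn ?_
  rw [interior_Ici, Real.deriv_sinh]
  intro x hx y hy hxy
  rw [Real.cosh_le_cosh, abs_of_pos hx, abs_of_pos hy]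
  exact hxy

theorem mul_sinh_le_mul_sinh {p q : ℝ} (hq : 0 < q) (hqp : q ≤ p) :
    p * Real.sinh q ≤ q * Real.sinh p := by
  have hp : 0 < p := hq.trans_le hqp
  have h := convexOn_sinh_Ici.2 (Set.mem_Ici.2 le_rfl) (Set.mem_Ici.2 hp.le)
    (sub_nonneg.2 ((div_le_one hp).2 hqp)) (div_pos hq hp).le (sub_add_cancel 1 (q / p))
  simp only [smul_eq_mul, mul_zero, zero_add, Real.sinh_zero, div_mul_cancel₀ q hp.ne'] at h
  calc p * Real.sinh q ≤ p * (q / p * Real.sinh p) := by gcongr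
    _ = q * Real.sinh p := by field_simp

theorem two_mul_exp_mul_sinh (s t : ℝ) :
    2 * Real.exp s * Real.sinh t = Real.exp (s + t) - Real.exp (s - t) := by
  rw [Real.sinh_eq, sub_eq_add_neg s, Real.exp_add, Real.exp_add]
  ring

/-- A combination of a decaying and a growing exponential is monotone on `[0, ∞)` as soon as its
derivative at `0` is nonnegative. -/
theorem monotoneOn_mul_exp_neg_add_mul_exp {A B p q : ℝ} (hA : 0 ≤ A) (hB : 0 ≤ B) (hp : 0 ≤ p)
    (hq : 0 ≤ q) (h : A * p ≤ B * q) :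
    MonotoneOn (fun d : ℝ => A * Real.exp (-(p * d)) + B * Real.exp (q * d)) (Set.Ici 0) := by
  intro x hx y _ hxy
  have hx : 0 ≤ x := hx
  have hyx : 0 ≤ y - x := sub_nonneg.2 hxy
  have decay : Real.exp (-(p * x)) - Real.exp (-(p * y)) ≤ p * (y - x) := by
    have e : Real.exp (-(p * y)) = Real.exp (-(p * x)) * Real.exp (-(p * (y - x))) := by
      rw [← Real.exp_add]; ring_nf
    have h₁ : Real.exp (-(p * x)) ≤ 1 := Real.exp_le_one_iff.2 (by nlinarith [mul_nonneg hp hx])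
    have h₂ := Real.add_one_le_exp (-(p * (y - x)))
    nlinarith [Real.exp_pos (-(p * x)), mul_nonneg hp hyx]
  have growth : q * (y - x) ≤ Real.exp (q * y) - Real.exp (q * x) := by
    have e : Real.exp (q * y) = Real.exp (q * x) * Real.exp (q * (y - x)) := by
      rw [← Real.exp_add]; ring_nf
    have h₁ : 1 ≤ Real.exp (q * x) := Real.one_le_exp (mul_nonneg hq hx)
    have h₂ := Real.add_one_le_exp (q * (y - x))
    nlinarith [mul_nonneg hq hyx]
  have h₁ := mul_le_mul_of_nonneg_left decay hA
  have h₂ := mul_le_mul_of_nonneg_left growth hB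
  have h₃ := mul_le_mul_of_nonneg_right h hyx
  simp only
  linarith


/-- The function `f(d)` giving (up to the `tanh(a/2)` factor) the exponentiated
Rényi divergence of the shifted discrete Laplace distribution is monotone
increasing in the shift `d` on `[0, ∞)`. -/
theorem discrete_laplace_renyi_monotone (a : ℝ) (ha : 0 < a) (α : ℝ) (hα : 1 < α) :
    MonotoneOn (fun d : ℝ =>
      Real.exp (-a * α * d) / (Real.exp a - 1)
        + (Real.exp (a - a * α * d) - Real.exp (a * (α * (d + 2) - d)))
            / (Real.exp a - Real.exp (2 * a * α))
        + Real.exp (a * (α - 1) * d) / (Real.exp a - 1)) (Set.Ici 0) := by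
  have hq : 0 < a * (α - 1) := mul_pos ha (sub_pos.2 hα)
  have hqp : a * (α - 1) ≤ a * α := by linarith
  have hp : 0 < a * α := hq.trans_le hqp
  have sinh_le := mul_sinh_le_mul_sinh hq hqp
  have hE : 0 < Real.exp a - 1 := sub_pos.2 (Real.one_lt_exp_iff.2 ha)
  have hQE : 0 < Real.exp (2 * a * α) - Real.exp a :=
    sub_pos.2 (Real.exp_lt_exp.2 (by nlinarith))
  have hA : Real.exp (2 * a * α) - Real.exp a ^ 2
      = 2 * Real.exp (a * (α + 1)) * Real.sinh (a * (α - 1)) := by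
    rw [two_mul_exp_mul_sinh, ← Real.exp_nat_mul]
    push_cast
    ring_nf
  have hB : Real.exp a * (Real.exp (2 * a * α) - 1)
      = 2 * Real.exp (a * (α + 1)) * Real.sinh (a * α) := by
    rw [two_mul_exp_mul_sinh, mul_sub, ← Real.exp_add, mul_one]
    ring_nf
  have hD : 0 < (Real.exp a - 1) * (Real.exp (2 * a * α) - Real.exp a) := mul_pos hE hQE
  have mono := monotoneOn_mul_exp_neg_add_mul_exp
    (A := (Real.exp (2 * a * α) - Real.exp a ^ 2)
      / ((Real.exp a - 1) * (Real.exp (2 * a * α) - Real.exp a)))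
    (B := Real.exp a * (Real.exp (2 * a * α) - 1)
      / ((Real.exp a - 1) * (Real.exp (2 * a * α) - Real.exp a)))
    (div_nonneg (by rw [hA]; have := Real.sinh_nonneg_iff.2 hq.le; positivity) hD.le)
    (div_nonneg (by rw [hB]; have := Real.sinh_nonneg_iff.2 hp.le; positivity) hD.le)
    hp.le hq.le (by
      rw [div_mul_eq_mul_div, div_mul_eq_mul_div, hA, hB]
      refine div_le_div_of_nonneg_right ?_ hD.le
      have := mul_le_mul_of_nonneg_left sinh_le
        (mul_pos two_pos (Real.exp_pos (a * (α + 1)))).le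
      linarith)
  refine mono.congr fun d _ => ?_
  have e₁ : Real.exp (a - a * α * d) = Real.exp a * Real.exp (-(a * α * d)) := by
    rw [← Real.exp_add, sub_eq_add_neg]
  have e₂ : Real.exp (a * (α * (d + 2) - d))
      = Real.exp (2 * a * α) * Real.exp (a * (α - 1) * d) := by
    rw [← Real.exp_add]; ring_nf
  have e₃ : -a * α * d = -(a * α * d) := by ring
  simp only [e₁, e₂, e₃]
  have hE' := hE.ne'
  have hQE' := hQE.ne'
  rw [← neg_sub (Real.exp (2 * a * α)) (Real.exp a)]
  field_simp
  ring
end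

section
/- For all real ε > 0, every natural number Δ ≥ 1, and all real α > 1, setting a = ε/Δ, one has (1/(α−1)) · log( tanh(a/2) · ( exp(−a·α·Δ)/(exp(a)−1) + (exp(a − a·α·Δ) − exp(a·(α·(Δ+2) − Δ)))/(exp(a) − exp(2·a·α)) + exp(a·(α−1)·Δ)/(exp(a)−1) ) ) ≤ α · a · ( Δ + (exp(−a·Δ) − 1)·csch(a) ). -/
open Polynomial
theorem mul_sinh_le {p r : ℝ} (hp : 0 ≤ p) (hpr : p ≤ r) : r * Real.sinh p ≤ p * Real.sinh r := by
  have hc : ConvexOn ℝ (Set.Ici 0) Real.sinh := by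
    apply MonotoneOn.convexOn_of_deriv (convex_Ici 0) Real.continuous_sinh.continuousOn
      Real.differentiable_sinh.differentiableOn
    intro x hx y hy hxy
    simp only [interior_Ici, Set.mem_Ioi] at hx hy
    simp only [Real.deriv_sinh]
    rw [Real.cosh_le_cosh, abs_of_pos hx, abs_of_pos hy]
    exact hxy
  rcases hp.eq_or_lt with rfl | hp
  · simp
  have hr := hp.trans_le hpr
  have := hc.2 (Set.mem_Ici.2 le_rfl) (Set.mem_Ici.2 hr.le)
    (sub_nonneg.2 ((div_le_one hr).2 hpr)) (div_nonneg hp.le hr.le) (sub_add_cancel 1 (p / r))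
  simp only [smul_eq_mul, mul_zero, Real.sinh_zero, zero_add, div_mul_cancel₀ p hr.ne'] at this
  rw [div_mul_eq_mul_div, le_div_iff₀ hr] at this
  linarith

theorem mul_cosh_sub_mul_sinh_le {x a t : ℝ} (hx : |x| ≤ 1) (ha : 0 ≤ a) (hat : a ≤ t) :
    a * (Real.cosh a - x) * Real.sinh t ≤ t * (Real.cosh t - x) * Real.sinh a := by
  obtain ⟨p, rfl⟩ : ∃ p, a = 2 * p := ⟨a / 2, by ring⟩
  obtain ⟨r, rfl⟩ : ∃ r, t = 2 * r := ⟨t / 2, by ring⟩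
  obtain ⟨hx1, hx2⟩ := abs_le.1 hx
  have hp : 0 ≤ p := by linarith
  have hpr : p ≤ r := by linarith
  have h1 := mul_sinh_le (p := r - p) (r := r + p) (by linarith) (by linarith)
  have h2 : 0 ≤ Real.sinh (r - p) := Real.sinh_nonneg_iff.2 (by linarith)
  have sp : 0 ≤ Real.sinh p := Real.sinh_nonneg_iff.2 hp
  have sr : 0 ≤ Real.sinh r := Real.sinh_nonneg_iff.2 (hp.trans hpr)
  have cp := Real.cosh_pos p
  have cr := Real.cosh_pos r
  rw [Real.sinh_sub, Real.sinh_add] at h1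
  rw [Real.sinh_sub] at h2
  simp only [Real.sinh_two_mul, Real.cosh_two_mul]
  have ep := Real.cosh_sq p
  have er := Real.cosh_sq r
  have k1 : p * (Real.sinh p * Real.cosh r) ≤ r * (Real.sinh r * Real.cosh p) :=
    mul_le_mul hpr (by linarith) (by positivity) (by linarith)
  have k2 : p * (Real.sinh r * Real.cosh p) ≤ r * (Real.sinh p * Real.cosh r) := by linarith
  have hx1' : 0 ≤ 1 + x := by linarith
  have hx2' : 0 ≤ 1 - x := by linarith
  have m1 := mul_le_mul_of_nonneg_left k1
    (mul_nonneg hx1' (show 0 ≤ Real.sinh p * Real.sinh r by positivity))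
  have m2 := mul_le_mul_of_nonneg_left k2
    (mul_nonneg hx2' (show 0 ≤ Real.cosh p * Real.cosh r by positivity))
  have e1 : Real.cosh p ^ 2 + Real.sinh p ^ 2 - x
      = (1 + x) * Real.sinh p ^ 2 + (1 - x) * Real.cosh p ^ 2 := by rw [ep]; ring
  have e2 : Real.cosh r ^ 2 + Real.sinh r ^ 2 - x
      = (1 + x) * Real.sinh r ^ 2 + (1 - x) * Real.cosh r ^ 2 := by rw [er]; ring
  rw [e1, e2]
  linarith

theorem cosh_sub_pos {x t : ℝ} (hx : |x| ≤ 1) (ht : 0 < t) : 0 < Real.cosh t - x := by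
  have := Real.one_lt_cosh.2 ht.ne'
  have := (abs_le.1 hx).2
  linarith

theorem hasDerivAt_log_cosh_sub {x t : ℝ} (hx : |x| ≤ 1) (ht : 0 < t) :
    HasDerivAt (fun t => Real.log (Real.cosh t - x)) (Real.sinh t / (Real.cosh t - x)) t :=
  ((Real.hasDerivAt_cosh t).sub_const x).log (cosh_sub_pos hx ht).ne'

theorem log_cosh_sub_le {x a t : ℝ} (hx : |x| ≤ 1) (ha : 0 < a) (hat : a ≤ t) :
    Real.log (Real.cosh t - x) - Real.log (Real.cosh a - x)
      ≤ (t ^ 2 - a ^ 2) / (2 * a) * (Real.sinh a / (Real.cosh a - x)) := by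
  set q := Real.sinh a / (Real.cosh a - x) with hq
  have hd : ∀ s, a ≤ s → HasDerivAt
      (fun s => Real.log (Real.cosh s - x) - (s ^ 2 - a ^ 2) / (2 * a) * q)
      (Real.sinh s / (Real.cosh s - x) - s / a * q) s := fun s hs => by
    have h := ((((hasDerivAt_id s).pow 2).sub_const (a ^ 2)).div_const (2 * a)).mul_const q
    refine ((hasDerivAt_log_cosh_sub hx (ha.trans_le hs)).sub h).congr_deriv ?_
    simp only [id, Nat.cast_ofNat, Nat.reduceSub, pow_one, mul_one]
    field_simp
  have hanti : AntitoneOn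
      (fun s => Real.log (Real.cosh s - x) - (s ^ 2 - a ^ 2) / (2 * a) * q) (Set.Ici a) := by
    refine antitoneOn_of_deriv_nonpos (convex_Ici a)
      (fun s hs => (hd s hs).continuousAt.continuousWithinAt)
      (fun s hs => (hd s (interior_subset hs)).differentiableAt.differentiableWithinAt) ?_
    intro s hs
    have hs : a ≤ s := interior_subset hs
    rw [(hd s hs).deriv, sub_nonpos, hq, div_mul_div_comm,
      div_le_div_iff₀ (cosh_sub_pos hx (ha.trans_le hs)) (mul_pos ha (cosh_sub_pos hx ha))]
    linarith [mul_cosh_sub_mul_sinh_le hx ha.le hs]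
  have := hanti (Set.mem_Ici.2 le_rfl) (Set.mem_Ici.2 hat) hat
  simp only [sub_self, zero_div, zero_mul, sub_zero] at this
  linarith

theorem sum_log_cosh_sub_tangent (S : Multiset ℂ) (hS : ∀ w ∈ S, ‖w‖ = 1) {a : ℝ} (ha : 0 < a) :
    ∃ D, HasDerivAt (fun t => (S.map fun w => Real.log (Real.cosh t - w.re)).sum) D a ∧
      ∀ t, a ≤ t → (S.map fun w => Real.log (Real.cosh t - w.re)).sum
        - (S.map fun w => Real.log (Real.cosh a - w.re)).sum ≤ (t ^ 2 - a ^ 2) / (2 * a) * D := by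
  induction S using Multiset.induction with
  | empty => exact ⟨0, by simpa using hasDerivAt_const a (0 : ℝ), by simp⟩
  | cons w S ih =>
    obtain ⟨D, hD, hle⟩ := ih fun v hv => hS v (Multiset.mem_cons_of_mem hv)
    have hw : |w.re| ≤ 1 := (Complex.abs_re_le_norm w).trans (hS w (Multiset.mem_cons_self w S)).le
    refine ⟨_, by simpa only [Multiset.map_cons, Multiset.sum_cons] using
      (hasDerivAt_log_cosh_sub hw ha).fun_add hD, fun t ht => ?_⟩
    simp only [Multiset.map_cons, Multiset.sum_cons]
    linarith [hle t ht, log_cosh_sub_le hw ha ht]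

theorem norm_exp_sub_sq {w : ℂ} (hw : ‖w‖ = 1) (t : ℝ) :
    ‖(Real.exp t : ℂ) - w‖ ^ 2 = 2 * Real.exp t * (Real.cosh t - w.re) := by
  have h : w.re * w.re + w.im * w.im = 1 := by
    rw [← Complex.normSq_apply, Complex.normSq_eq_norm_sq, hw]; norm_num
  rw [← Complex.normSq_eq_norm_sq, Complex.normSq_apply, Real.cosh_eq, Real.exp_neg]
  simp only [Complex.sub_re, Complex.sub_im, Complex.ofReal_re, Complex.ofReal_im]
  have := Real.exp_pos t
  field_simp
  linarith

theorem log_norm_prod_exp_sub (S : Multiset ℂ) (hS : ∀ w ∈ S, ‖w‖ = 1) {t : ℝ} (ht : 0 < t) :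
    0 < ‖(S.map fun w => (Real.exp t : ℂ) - w).prod‖ ∧
    2 * Real.log ‖(S.map fun w => (Real.exp t : ℂ) - w).prod‖
      = S.card * (Real.log 2 + t) + (S.map fun w => Real.log (Real.cosh t - w.re)).sum := by
  induction S using Multiset.induction with
  | empty => simp
  | cons w S ih =>
    obtain ⟨h0, h⟩ := ih fun v hv => hS v (Multiset.mem_cons_of_mem hv)
    have hw := hS w (Multiset.mem_cons_self w S)
    have hpos := cosh_sub_pos ((Complex.abs_re_le_norm w).trans hw.le) ht
    have hsq := norm_exp_sub_sq hw t
    have hn : 0 < ‖(Real.exp t : ℂ) - w‖ := by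
      have : 0 < ‖(Real.exp t : ℂ) - w‖ ^ 2 := by rw [hsq]; positivity
      exact pos_of_mul_pos_left (by simpa only [sq] using this) (norm_nonneg _)
    have hl : 2 * Real.log ‖(Real.exp t : ℂ) - w‖
        = Real.log 2 + t + Real.log (Real.cosh t - w.re) := by
      have := congrArg Real.log hsq
      rw [Real.log_pow, Real.log_mul (by positivity) hpos.ne', Real.log_mul (by positivity)
        (by positivity), Real.log_exp] at this
      exact_mod_cast this
    simp only [Multiset.map_cons, Multiset.prod_cons, Multiset.sum_cons, norm_mul,
      Multiset.card_cons]
    refine ⟨mul_pos hn h0, ?_⟩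
    rw [Real.log_mul hn.ne' h0.ne', mul_add, hl, h]
    push_cast
    ring

theorem log_norm_eval_exp_sub_le (P : ℂ[X]) (hP : P ≠ 0) (hroots : ∀ w ∈ P.roots, ‖w‖ = 1)
    {a t D : ℝ} (ha : 0 < a) (hat : a ≤ t)
    (hD : HasDerivAt (fun t : ℝ => Real.log ‖P.eval (Real.exp t : ℂ)‖) D a) :
    Real.log ‖P.eval (Real.exp t : ℂ)‖ - Real.log ‖P.eval (Real.exp a : ℂ)‖
      ≤ P.natDegree / 2 * (t - a) + (t ^ 2 - a ^ 2) / (2 * a) * (D - P.natDegree / 2) := by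
  obtain ⟨E, hE, hle⟩ := sum_log_cosh_sub_tangent P.roots hroots ha
  have hsplit := IsAlgClosed.splits P
  have key : ∀ s, 0 < s → Real.log ‖P.eval (Real.exp s : ℂ)‖
      = Real.log ‖P.leadingCoeff‖ + (P.natDegree * (Real.log 2 + s)
        + (P.roots.map fun w => Real.log (Real.cosh s - w.re)).sum) / 2 := fun s hs => by
    obtain ⟨h0, h⟩ := log_norm_prod_exp_sub P.roots hroots hs
    rw [hsplit.eval_eq_prod_roots, norm_mul,
      Real.log_mul (norm_ne_zero_iff.2 (leadingCoeff_ne_zero.2 hP)) h0.ne',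
      hsplit.natDegree_eq_card_roots, ← h]
    ring
  have hDE : D = (P.natDegree + E) / 2 := by
    refine hD.unique (HasDerivAt.congr_of_eventuallyEq
      (((((hasDerivAt_id a).const_add (Real.log 2)).const_mul (P.natDegree : ℝ)).fun_add
        hE).div_const 2 |>.const_add (Real.log ‖P.leadingCoeff‖) |>.congr_deriv ?_) ?_)
    · rw [mul_one]
    · filter_upwards [lt_mem_nhds ha] with s hs using key s hs
  rw [key t (ha.trans_le hat), key a ha, hDE]
  linarith [hle t hat]

theorem norm_eq_one_of_pow_mul_eq {c : ℝ} (hc : 0 ≤ c) (n : ℕ) {w : ℂ}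
    (h : w ^ n * ((1 + c) * w - c) = (1 + c) - c * w) : ‖w‖ = 1 := by
  have hsq : ‖(1 + c) * w - c‖ ^ 2 - ‖(1 + c) - c * w‖ ^ 2 = (1 + 2 * c) * (‖w‖ ^ 2 - 1) := by
    simp only [← Complex.normSq_eq_norm_sq, Complex.normSq_apply]
    simp
    ring
  have hn := congrArg norm h
  rw [norm_mul, norm_pow] at hn
  have h0 := norm_nonneg ((1 + c) * w - c)
  have h0' := norm_nonneg ((1 + c) - c * w)
  rcases lt_trichotomy ‖w‖ 1 with hw | hw | hw
  · have h1 : ‖w‖ ^ n ≤ 1 := pow_le_one₀ (norm_nonneg w) hw.le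
    have h2 : ‖w‖ ^ 2 < 1 := pow_lt_one₀ (norm_nonneg w) hw two_ne_zero
    have h3 : ‖(1 + c) - c * w‖ ≤ ‖(1 + c) * w - c‖ := by
      rw [← hn]; exact mul_le_of_le_one_left h0 h1
    nlinarith [pow_le_pow_left₀ h0' h3 2]
  · exact hw
  · have h1 : 1 ≤ ‖w‖ ^ n := one_le_pow₀ hw.le
    have h2 : 1 < ‖w‖ ^ 2 := one_lt_pow₀ hw two_ne_zero
    have h3 : ‖(1 + c) * w - c‖ ≤ ‖(1 + c) - c * w‖ := by
      rw [← hn]; exact le_mul_of_one_le_left h0 h1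
    nlinarith [pow_le_pow_left₀ h0 h3 2]

/-- The geometric sum `1 + w + ⋯ + w ^ n` with extra weight `c` on its two end terms. -/
noncomputable def endWeightedGeomSum (n : ℕ) (c : ℝ) : ℂ[X] :=
  ∑ j ∈ Finset.range (n + 1), X ^ j + C (c : ℂ) * (X ^ n + 1)

theorem eval_endWeightedGeomSum (n : ℕ) (c : ℝ) (w : ℂ) :
    (endWeightedGeomSum n c).eval w = ∑ j ∈ Finset.range (n + 1), w ^ j + c * (w ^ n + 1) := by
  simp [endWeightedGeomSum, eval_finsetSum]

theorem coeff_endWeightedGeomSum_self {n : ℕ} (hn : n ≠ 0) (c : ℝ) :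
    (endWeightedGeomSum n c).coeff n = 1 + c := by
  simp [endWeightedGeomSum, coeff_X_pow, coeff_one, hn]

theorem natDegree_endWeightedGeomSum {n : ℕ} (hn : n ≠ 0) {c : ℝ} (hc : 0 ≤ c) :
    (endWeightedGeomSum n c).natDegree = n := by
  refine natDegree_eq_of_le_of_coeff_ne_zero ?_ ?_
  · refine natDegree_add_le_of_degree_le (natDegree_sum_le_of_forall_le _ _ fun j hj => ?_) ?_
    · rw [natDegree_X_pow]
      exact Nat.lt_succ_iff.1 (Finset.mem_range.1 hj)
    · refine (natDegree_C_mul_le _ _).trans (natDegree_add_le_of_degree_le ?_ ?_)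
      · rw [natDegree_X_pow]
      · simp
  · rw [coeff_endWeightedGeomSum_self hn]
    exact_mod_cast (by positivity : (1 : ℝ) + c ≠ 0)

theorem endWeightedGeomSum_ne_zero {n : ℕ} (hn : n ≠ 0) {c : ℝ} (hc : 0 ≤ c) :
    endWeightedGeomSum n c ≠ 0 := fun h => hn <| by
  rw [← natDegree_endWeightedGeomSum hn hc, h, natDegree_zero]

theorem norm_of_mem_roots_endWeightedGeomSum {n : ℕ} {c : ℝ} (hc : 0 ≤ c) {w : ℂ}
    (hw : w ∈ (endWeightedGeomSum n c).roots) : ‖w‖ = 1 := by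
  have h := (mem_roots'.1 hw).2
  rw [IsRoot.def, eval_endWeightedGeomSum] at h
  refine norm_eq_one_of_pow_mul_eq hc n ?_
  have hg := geom_sum_mul w (n + 1)
  linear_combination (w - 1) * h - hg

theorem norm_eval_exp_endWeightedGeomSum (n : ℕ) {c : ℝ} (hc : 0 ≤ c) {t : ℝ} (ht : 0 < t) :
    ‖(endWeightedGeomSum n c).eval (Real.exp t : ℂ)‖
      = (Real.exp t ^ (n + 1) - 1) / (Real.exp t - 1) + c * (Real.exp t ^ n + 1) := by
  have h1 : Real.exp t ≠ 1 := (Real.one_lt_exp_iff.2 ht).ne'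
  rw [← geom_sum_eq h1, eval_endWeightedGeomSum]
  have : 0 ≤ ∑ j ∈ Finset.range (n + 1), Real.exp t ^ j + c * (Real.exp t ^ n + 1) := by positivity
  rw [← Real.norm_of_nonneg this, ← Complex.norm_real]
  push_cast
  rfl

theorem norm_eval_exp_self_endWeightedGeomSum (n : ℕ) {a : ℝ} (ha : 0 < a) :
    ‖(endWeightedGeomSum n (1 / (Real.exp a - 1))).eval (Real.exp a : ℂ)‖
      = Real.exp a ^ n * (Real.exp a + 1) / (Real.exp a - 1) := by
  have h1 : 0 < Real.exp a - 1 := sub_pos.2 (Real.one_lt_exp_iff.2 ha)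
  rw [norm_eval_exp_endWeightedGeomSum n (by positivity) ha]
  field_simp
  ring

theorem hasDerivAt_log_norm_eval_exp_endWeightedGeomSum (n : ℕ) {a : ℝ} (ha : 0 < a) :
    HasDerivAt (fun t : ℝ => Real.log
        ‖(endWeightedGeomSum n (1 / (Real.exp a - 1))).eval (Real.exp t : ℂ)‖)
      (n + (Real.exp (-a * n) - 1) / (2 * Real.sinh a)) a := by
  have h1 : 0 < Real.exp a - 1 := sub_pos.2 (Real.one_lt_exp_iff.2 ha)
  have hy := Real.exp_pos a
  have hval := norm_eval_exp_self_endWeightedGeomSum n ha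
  set c := 1 / (Real.exp a - 1) with hc
  have hc0 : 0 ≤ c := by positivity
  have hexp := Real.hasDerivAt_exp a
  have hd := ((((hexp.fun_pow (n + 1)).sub_const 1).fun_div (hexp.sub_const 1) h1.ne').fun_add
    (((hexp.fun_pow n).add_const 1).const_mul c)).congr_of_eventuallyEq
      (f₁ := fun t : ℝ => ‖(endWeightedGeomSum n c).eval (Real.exp t : ℂ)‖) (by
        filter_upwards [lt_mem_nhds ha] with s hs
          using norm_eval_exp_endWeightedGeomSum n hc0 hs)
  have hpos : 0 < Real.exp a ^ n * (Real.exp a + 1) / (Real.exp a - 1) := by positivity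
  refine (hd.log (by rw [hval]; exact hpos.ne')).congr_deriv ?_
  have hpow : (n : ℝ) * Real.exp a ^ (n - 1) * Real.exp a = n * Real.exp a ^ n := by
    rcases n with _ | n
    · simp
    · rw [Nat.add_sub_cancel, pow_succ, mul_assoc]
  have hneg : Real.exp (-a * n) = (Real.exp a ^ n)⁻¹ := by
    rw [← Real.exp_nat_mul, ← Real.exp_neg]; ring_nf
  have hsinh : 2 * Real.sinh a = (Real.exp a - 1) * (Real.exp a + 1) / Real.exp a := by
    rw [Real.sinh_eq, Real.exp_neg]; field_simp; ring
  rw [hval, hpow, hneg, hsinh, hc, Nat.add_sub_cancel]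
  generalize Real.exp a = y at *
  have hyn : 0 < y ^ n := by positivity
  push_cast
  rw [pow_succ]
  generalize y ^ n = z at *
  have h1' := h1.ne'
  have h3 : y + 1 ≠ 0 := by positivity
  field_simp
  ring

theorem discrete_laplace_renyi_moment_eq (n : ℕ) {a α : ℝ} (ha : 0 < a) (hα : 1 < α) :
    Real.tanh (a / 2) *
        (Real.exp (-a * α * n) / (Real.exp a - 1)
          + (Real.exp (a - a * α * n) - Real.exp (a * (α * (n + 2) - n)))
              / (Real.exp a - Real.exp (2 * a * α))
          + Real.exp (a * (α - 1) * n) / (Real.exp a - 1))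
      = Real.exp (-(a * n * (α - 1)))
        * ‖(endWeightedGeomSum n (1 / (Real.exp a - 1))).eval (Real.exp (a * (2 * α - 1)) : ℂ)‖
        / ‖(endWeightedGeomSum n (1 / (Real.exp a - 1))).eval (Real.exp a : ℂ)‖ := by
  have ht : 0 < a * (2 * α - 1) := mul_pos ha (by linarith)
  have h1 : 0 < Real.exp a - 1 := sub_pos.2 (Real.one_lt_exp_iff.2 ha)
  have h2 : 0 < Real.exp (a * (2 * α - 1)) - 1 := sub_pos.2 (Real.one_lt_exp_iff.2 ht)
  have hy := Real.exp_pos a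
  rw [norm_eval_exp_self_endWeightedGeomSum n ha,
    norm_eval_exp_endWeightedGeomSum n (by positivity) ht]
  have htanh : Real.tanh (a / 2) = (Real.exp a - 1) / (Real.exp a + 1) := by
    have hs : Real.exp a = Real.exp (a / 2) ^ 2 := by rw [← Real.exp_nat_mul]; ring_nf
    rw [Real.tanh_eq_sinh_div_cosh, Real.sinh_eq, Real.cosh_eq, Real.exp_neg, hs]
    have := Real.exp_pos (a / 2)
    field_simp
  have e1 : Real.exp (a - a * α * n) = Real.exp (-a * α * n) * Real.exp a := by
    rw [← Real.exp_add]; ring_nf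
  have e2 : Real.exp (a * (α * (n + 2) - n))
      = Real.exp (-a * α * n) * Real.exp a * Real.exp (a * (2 * α - 1)) ^ (n + 1) := by
    rw [← Real.exp_nat_mul, ← Real.exp_add, ← Real.exp_add]; push_cast; ring_nf
  have e3 : Real.exp (2 * a * α) = Real.exp a * Real.exp (a * (2 * α - 1)) := by
    rw [← Real.exp_add]; ring_nf
  have e4 : Real.exp (a * (α - 1) * n)
      = Real.exp (-a * α * n) * Real.exp (a * (2 * α - 1)) ^ n := by
    rw [← Real.exp_nat_mul, ← Real.exp_add]; ring_nf
  have e5 : Real.exp (-(a * n * (α - 1))) = Real.exp (-a * α * n) * Real.exp a ^ n := by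
    rw [← Real.exp_nat_mul, ← Real.exp_add]; ring_nf
  rw [htanh, e1, e2, e3, e4, e5]
  have hmid : (Real.exp (-a * α * n) * Real.exp a - Real.exp (-a * α * n) * Real.exp a
        * Real.exp (a * (2 * α - 1)) ^ (n + 1))
        / (Real.exp a - Real.exp a * Real.exp (a * (2 * α - 1)))
      = Real.exp (-a * α * n) * ((Real.exp (a * (2 * α - 1)) ^ (n + 1) - 1)
        / (Real.exp (a * (2 * α - 1)) - 1)) := by
    have h3 : Real.exp a - Real.exp a * Real.exp (a * (2 * α - 1)) ≠ 0 := by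
      have := mul_pos hy h2
      linarith
    rw [← mul_div_assoc, div_eq_div_iff h3 h2.ne']
    ring
  rw [hmid]
  generalize (Real.exp (a * (2 * α - 1)) ^ (n + 1) - 1) / (Real.exp (a * (2 * α - 1)) - 1) = g
  field_simp
  ring

/-- The ε-DP discrete Laplace mechanism with sensitivity Δ is
`ε·(1 − (1/Δ)·(1−e^{−ε})·csch(ε/Δ))`-zCDP, where the left-hand side is its
tight order-α Rényi divergence. Here `a = ε/Δ` and `csch(x) = 1/sinh(x)`. -/
theorem discrete_laplace_zCDP (ε : ℝ) (hε : 0 < ε) (Δ : ℕ) (hΔ : 1 ≤ Δ) (α : ℝ) (hα : 1 < α) :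
    (1 / (α - 1)) *
      Real.log (Real.tanh ((ε / Δ) / 2) *
        (Real.exp (-(ε / Δ) * α * Δ) / (Real.exp (ε / Δ) - 1)
          + (Real.exp ((ε / Δ) - (ε / Δ) * α * Δ) - Real.exp ((ε / Δ) * (α * (Δ + 2) - Δ)))
              / (Real.exp (ε / Δ) - Real.exp (2 * (ε / Δ) * α))
          + Real.exp ((ε / Δ) * (α - 1) * Δ) / (Real.exp (ε / Δ) - 1)))
      ≤ α * ((ε / Δ) * (Δ + (Real.exp (-(ε / Δ) * Δ) - 1) * (1 / Real.sinh (ε / Δ)))) := by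
  have hΔ0 : Δ ≠ 0 := Nat.one_le_iff_ne_zero.1 hΔ
  have ha : 0 < ε / Δ := div_pos hε (Nat.cast_pos.2 hΔ)
  generalize ε / Δ = a at ha
  have hc : 0 ≤ 1 / (Real.exp a - 1) :=
    one_div_nonneg.2 (sub_pos.2 (Real.one_lt_exp_iff.2 ha)).le
  have hat : a ≤ a * (2 * α - 1) := le_mul_of_one_le_right ha.le (by linarith)
  have hpos : ∀ t, 0 < t →
      ‖(endWeightedGeomSum Δ (1 / (Real.exp a - 1))).eval (Real.exp t : ℂ)‖ ≠ 0 := by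
    intro t ht h0
    have hroot := norm_of_mem_roots_endWeightedGeomSum hc
      ((mem_roots (endWeightedGeomSum_ne_zero hΔ0 hc)).2 (norm_eq_zero.1 h0))
    rw [Complex.norm_real, Real.norm_of_nonneg (Real.exp_pos t).le] at hroot
    exact (Real.one_lt_exp_iff.2 ht).ne' hroot
  have hle := log_norm_eval_exp_sub_le _ (endWeightedGeomSum_ne_zero hΔ0 hc)
    (fun w => norm_of_mem_roots_endWeightedGeomSum hc) ha hat
    (hasDerivAt_log_norm_eval_exp_endWeightedGeomSum Δ ha)
  rw [natDegree_endWeightedGeomSum hΔ0 hc] at hle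
  have hpt := hpos _ (ha.trans_le hat)
  rw [discrete_laplace_renyi_moment_eq Δ ha hα, Real.log_div
    (mul_ne_zero (Real.exp_ne_zero _) hpt) (hpos a ha), Real.log_mul (Real.exp_ne_zero _) hpt,
    Real.log_exp, one_div_mul_eq_div, div_le_iff₀ (sub_pos.2 hα)]
  have hsq : ((a * (2 * α - 1)) ^ 2 - a ^ 2) / (2 * a) = 2 * a * α * (α - 1) := by
    field_simp
    ring
  rw [hsq] at hle
  have hsinh : (Real.exp (-a * Δ) - 1) / (2 * Real.sinh a)
      = (Real.exp (-a * Δ) - 1) * (1 / Real.sinh a) / 2 := by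
    rw [mul_one_div, div_div, mul_comm 2]
  rw [hsinh] at hle
  linarith
end

section
/- For every natural number k ≥ 2 and all real ε > 0, the limit as α → 1⁺ of (1/(α−1)) · log( (exp(α·ε) + exp((1−α)·ε) + k − 2)/(k − 1 + exp(ε)) ) equals ε·(exp(ε) − 1)/(exp(ε) − 1 + k). -/
open Filter

/-- The moment of `k`-Randomized Response at `α = 1` is the total mass `1`. -/
theorem kRR_moment_one {k : ℝ} (hk : 1 ≤ k) (ε : ℝ) :
    (Real.exp (1 * ε) + Real.exp ((1 - 1) * ε) + k - 2) / (k - 1 + Real.exp ε) = 1 := by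
  have hpos : 0 < k - 1 + Real.exp ε := by linarith [Real.exp_pos ε]
  rw [div_eq_one_iff_eq hpos.ne', one_mul, sub_self, zero_mul, Real.exp_zero]
  ring

/-- Derivative at `α = 1` of the logarithmic moment of `k`-Randomized Response. -/
theorem hasDerivAt_log_kRR_moment {k : ℝ} (hk : 1 ≤ k) (ε : ℝ) :
    HasDerivAt (fun α : ℝ =>
        Real.log ((Real.exp (α * ε) + Real.exp ((1 - α) * ε) + k - 2)
          / (k - 1 + Real.exp ε)))
      (ε * (Real.exp ε - 1) / (Real.exp ε - 1 + k)) 1 := by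
  have hone := kRR_moment_one hk ε
  have hexp : HasDerivAt (fun α : ℝ => Real.exp (α * ε)) (Real.exp (1 * ε) * (1 * ε)) 1 :=
    ((hasDerivAt_id (1 : ℝ)).mul_const ε).exp
  have hexp_neg : HasDerivAt (fun α : ℝ => Real.exp ((1 - α) * ε))
      (Real.exp ((1 - 1) * ε) * (-1 * ε)) 1 :=
    (((hasDerivAt_id (1 : ℝ)).const_sub 1).mul_const ε).exp
  have hlog := ((((hexp.fun_add hexp_neg).add_const k).sub_const 2).div_const
    (k - 1 + Real.exp ε)).log (by rw [hone]; exact one_ne_zero)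
  convert hlog using 1
  rw [hone, div_one, one_mul, sub_self, zero_mul, Real.exp_zero,
    show Real.exp ε - 1 + k = k - 1 + Real.exp ε by ring]
  ring

/-- The limit as α → 1⁺ of the tight RDP curve of ε-DP k-Randomized Response
equals ε·(e^ε − 1)/(e^ε − 1 + k). -/
theorem kRR_rdp_limit (k : ℕ) (hk : 2 ≤ k) (ε : ℝ) (hε : 0 < ε) :
    Tendsto (fun α : ℝ =>
        (1 / (α - 1)) *
          Real.log ((Real.exp (α * ε) + Real.exp ((1 - α) * ε) + (k : ℝ) - 2)
            / ((k : ℝ) - 1 + Real.exp ε)))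
      (nhdsWithin 1 (Set.Ioi 1))
      (nhds (ε * (Real.exp ε - 1) / (Real.exp ε - 1 + k))) := by
  have hk' : (1 : ℝ) ≤ k := by exact_mod_cast (one_le_two.trans hk)
  have hslope := (hasDerivAt_iff_tendsto_slope.mp (hasDerivAt_log_kRR_moment hk' ε)).mono_left
    (nhdsWithin_mono 1 fun _ hx => ne_of_gt hx)
  refine hslope.congr fun α => ?_
  rw [slope_def_field, kRR_moment_one hk' ε, Real.log_one, sub_zero, one_div, div_eq_inv_mul]
end

section
/- For every natural number k with 2 ≤ k ≤ 6, all real ε > 0, and all real α > 1, (1/(α·(α−1))) · log( (exp(α·ε) + exp((1−α)·ε) + k − 2)/(k − 1 + exp(ε)) ) ≤ ε·(exp(ε) − 1)/(exp(ε) + k − 1). (This states that the ε-DP k-RR mechanism is (ε·(e^ε − 1)/(e^ε − 1 + k))-zCDP for 2 ≤ k ≤ 6.) -/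
/-- The numerator of the derivative of `-(sinh s / (s (cosh s + m)))` is nonnegative. -/
lemma mul_one_add_mul_cosh_le {m s : ℝ} (hm : m ≤ 2) (hs : 0 ≤ s) :
    s * (1 + m * Real.cosh s) ≤ Real.sinh s * (Real.cosh s + m) := by
  have hderiv (x : ℝ) : HasDerivAt
      (fun x ↦ Real.sinh x * Real.cosh x - x + 2 * (Real.sinh x - x * Real.cosh x))
      (2 * Real.sinh x * (Real.sinh x - x)) x := by
    have h := (((Real.hasDerivAt_sinh x).mul (Real.hasDerivAt_cosh x)).sub (hasDerivAt_id x)).add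
      (((Real.hasDerivAt_sinh x).sub ((hasDerivAt_id x).mul (Real.hasDerivAt_cosh x))).const_mul 2)
    refine h.congr_deriv ?_
    simp only [id]
    linear_combination Real.cosh_sq x
  have hmono : MonotoneOn
      (fun x ↦ Real.sinh x * Real.cosh x - x + 2 * (Real.sinh x - x * Real.cosh x))
      (Set.Ici 0) := by
    refine monotoneOn_of_deriv_nonneg (convex_Ici 0)
      (fun x _ ↦ (hderiv x).continuousAt.continuousWithinAt)
      (fun x _ ↦ (hderiv x).differentiableAt.differentiableWithinAt) fun x hx ↦ ?_
    rw [interior_Ici] at hx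
    have hx0 : 0 ≤ x := le_of_lt hx
    rw [(hderiv x).deriv]
    exact mul_nonneg (mul_nonneg zero_le_two (Real.sinh_nonneg_iff.2 hx0))
      (sub_nonneg.2 (Real.self_le_sinh_iff.2 hx0))
  have htwo := hmono Set.self_mem_Ici hs hs
  have hsinh : Real.sinh s ≤ s * Real.cosh s := by
    have hmono' : MonotoneOn (fun x ↦ x * Real.cosh x - Real.sinh x) (Set.Ici 0) := by
      have hd (x : ℝ) : HasDerivAt (fun x ↦ x * Real.cosh x - Real.sinh x)
          (x * Real.sinh x) x := by
        refine (((hasDerivAt_id x).mul (Real.hasDerivAt_cosh x)).sub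
          (Real.hasDerivAt_sinh x)).congr_deriv ?_
        simp only [id]
        ring
      refine monotoneOn_of_deriv_nonneg (convex_Ici 0)
        (fun x _ ↦ (hd x).continuousAt.continuousWithinAt)
        (fun x _ ↦ (hd x).differentiableAt.differentiableWithinAt) fun x hx ↦ ?_
      rw [interior_Ici] at hx
      have hx0 : 0 ≤ x := le_of_lt hx
      rw [(hd x).deriv]
      exact mul_nonneg hx0 (Real.sinh_nonneg_iff.2 hx0)
    have := hmono' Set.self_mem_Ici hs hs
    simp only [Real.sinh_zero, zero_mul, sub_zero] at this
    linarith
  simp only [Real.sinh_zero, Real.cosh_zero, zero_mul, sub_zero, mul_zero, add_zero] at htwo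
  nlinarith [mul_nonneg (sub_nonneg.2 hm) (sub_nonneg.2 hsinh)]

lemma antitoneOn_sinh_div_mul_cosh_add {m : ℝ} (hm0 : 0 ≤ m) (hm : m ≤ 2) :
    AntitoneOn (fun s ↦ Real.sinh s / (s * (Real.cosh s + m))) (Set.Ioi 0) := by
  have hd (s : ℝ) (hs : 0 < s) := (Real.hasDerivAt_sinh s).div
    ((hasDerivAt_id s).mul ((Real.hasDerivAt_cosh s).add_const m))
    (mul_pos hs (add_pos_of_pos_of_nonneg (Real.cosh_pos s) hm0)).ne'
  refine antitoneOn_of_deriv_nonpos (convex_Ioi 0)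
    (fun s hs ↦ (hd s hs).continuousAt.continuousWithinAt)
    (fun s hs ↦ (hd s (by simpa using hs)).differentiableAt.differentiableWithinAt) fun s hs ↦ ?_
  rw [interior_Ioi] at hs
  refine (hd s hs).deriv.trans_le (div_nonpos_of_nonpos_of_nonneg ?_ (sq_nonneg _))
  have h := mul_one_add_mul_cosh_le hm (le_of_lt hs)
  simp only [id, Pi.mul_apply]
  linear_combination h + s * Real.cosh_sq s

/-- Since `log (cosh s + m)` is concave in `s ^ 2`, it lies below its tangent at `s = c`. -/
lemma log_cosh_add_div_le {m c s : ℝ} (hm0 : 0 ≤ m) (hm : m ≤ 2) (hc : 0 < c) (hcs : c ≤ s) :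
    Real.log ((Real.cosh s + m) / (Real.cosh c + m)) ≤
      (s ^ 2 - c ^ 2) / 2 * (Real.sinh c / (c * (Real.cosh c + m))) := by
  have hpos (x : ℝ) : 0 < Real.cosh x + m := add_pos_of_pos_of_nonneg (Real.cosh_pos x) hm0
  set A := Real.sinh c / (c * (Real.cosh c + m))
  have hd (x : ℝ) : HasDerivAt (fun x ↦ x ^ 2 / 2 * A - Real.log (Real.cosh x + m))
      (x * A - Real.sinh x / (Real.cosh x + m)) x := by
    refine ((((hasDerivAt_pow 2 x).div_const 2).mul_const A).sub
      (((Real.hasDerivAt_cosh x).add_const m).log (hpos x).ne')).congr_deriv ?_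
    simp
  have hmono : MonotoneOn (fun x ↦ x ^ 2 / 2 * A - Real.log (Real.cosh x + m)) (Set.Ici c) := by
    refine monotoneOn_of_deriv_nonneg (convex_Ici c)
      (fun x _ ↦ (hd x).continuousAt.continuousWithinAt)
      (fun x _ ↦ (hd x).differentiableAt.differentiableWithinAt) fun x hx ↦ ?_
    rw [interior_Ici] at hx
    have hcx : c < x := hx
    have hx0 : 0 < x := hc.trans hcx
    have h : Real.sinh x / (x * (Real.cosh x + m)) ≤ A :=
      antitoneOn_sinh_div_mul_cosh_add hm0 hm hc hx0 hcx.le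
    have h' : Real.sinh x / (Real.cosh x + m) =
        x * (Real.sinh x / (x * (Real.cosh x + m))) := by
      have := (hpos x).ne'
      field_simp
    rw [(hd x).deriv, h']
    exact sub_nonneg.2 (mul_le_mul_of_nonneg_left h hx0.le)
  have h := hmono Set.self_mem_Ici hcs hcs
  rw [Real.log_div (hpos s).ne' (hpos c).ne']
  simp only at h
  linarith

/-- The ε-DP k-RR mechanism is (ε·(e^ε − 1)/(e^ε − 1 + k))-zCDP for 2 ≤ k ≤ 6. -/
theorem kRR_zCDP (k : ℕ) (hk2 : 2 ≤ k) (hk6 : k ≤ 6) (ε : ℝ) (hε : 0 < ε)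
    (α : ℝ) (hα : 1 < α) :
    (1 / (α * (α - 1))) *
      Real.log ((Real.exp (α * ε) + Real.exp ((1 - α) * ε) + (k : ℝ) - 2)
        / ((k : ℝ) - 1 + Real.exp ε))
      ≤ ε * (Real.exp ε - 1) / (Real.exp ε + (k : ℝ) - 1) := by
  have hk2' : (2 : ℝ) ≤ k := by exact_mod_cast hk2
  have hk6' : (k : ℝ) ≤ 6 := by exact_mod_cast hk6
  obtain ⟨c, rfl⟩ : ∃ c, ε = 2 * c := ⟨ε / 2, by ring⟩
  have hc : 0 < c := by linarith
  set m : ℝ := (k - 2) / 2 * Real.exp (-c) with hm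
  have hm0 : 0 ≤ m := mul_nonneg (by linarith) (Real.exp_pos _).le
  have hm2 : m ≤ 2 := by
    have : Real.exp (-c) ≤ 1 := Real.exp_le_one_iff.2 (by linarith)
    nlinarith [Real.exp_pos (-c)]
  have hcs : c ≤ (2 * α - 1) * c := by nlinarith
  have hinv : Real.exp c * Real.exp (-c) = 1 := by rw [← Real.exp_add]; simp
  have hsq : Real.exp (2 * c) = Real.exp c * Real.exp c := by rw [← Real.exp_add]; ring_nf
  have hnum : Real.exp (α * (2 * c)) + Real.exp ((1 - α) * (2 * c)) + (k : ℝ) - 2 =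
      2 * Real.exp c * (Real.cosh ((2 * α - 1) * c) + m) := by
    have h1 : Real.exp (α * (2 * c)) = Real.exp c * Real.exp ((2 * α - 1) * c) := by
      rw [← Real.exp_add]; ring_nf
    have h2 : Real.exp ((1 - α) * (2 * c)) = Real.exp c * Real.exp (-((2 * α - 1) * c)) := by
      rw [← Real.exp_add]; ring_nf
    rw [h1, h2, hm, Real.cosh_eq]
    linear_combination (2 - (k : ℝ)) * hinv
  have hden : Real.exp (2 * c) + (k : ℝ) - 1 = 2 * Real.exp c * (Real.cosh c + m) := by
    rw [hsq, hm, Real.cosh_eq]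
    linear_combination (1 - (k : ℝ)) * hinv
  have hsinh : Real.exp (2 * c) - 1 = 2 * Real.exp c * Real.sinh c := by
    rw [hsq, Real.sinh_eq]
    linear_combination hinv
  have hexp : (2 * Real.exp c) ≠ 0 := (mul_pos two_pos (Real.exp_pos c)).ne'
  have hpos : 0 < Real.cosh c + m := add_pos_of_pos_of_nonneg (Real.cosh_pos c) hm0
  have hα' : 0 < α * (α - 1) := mul_pos (by linarith) (by linarith)
  rw [show (k : ℝ) - 1 + Real.exp (2 * c) = Real.exp (2 * c) + k - 1 by ring, hnum, hden, hsinh,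
    mul_div_mul_left _ _ hexp, one_div, inv_mul_le_iff₀ hα']
  refine (log_cosh_add_div_le hm0 hm2 hc hcs).trans_eq ?_
  have hne := hpos.ne'
  field_simp
  ring
end

section
/- For all real ε > 0 and every real k satisfying k > 2·(exp(ε)−1)·(exp(ε)−1−ε) / (ε·(exp(ε)+1) − 2·exp(ε) + 2), there exists a real α > 1 such that (1/(α·(α−1))) · log( (exp(α·ε) + exp((1−α)·ε) + k − 2)/(k − 1 + exp(ε)) ) > ε·(exp(ε) − 1)/(exp(ε) − 1 + k). (Hence the ε-DP k-RR mechanism is not (ε·(e^ε−1)/(e^ε−1+k))-zCDP for such k.) -/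
/-- For `x > 0`, the trapezoid rule overestimates `∫₀ˣ eᵗ dt`. -/
theorem exp_trapezoid_pos {x : ℝ} (hx : 0 < x) :
    0 < x * (Real.exp x + 1) - 2 * Real.exp x + 2 := by
  have hd (y : ℝ) : HasDerivAt (fun y => y * (Real.exp y + 1) - 2 * Real.exp y + 2)
      (y * Real.exp y - Real.exp y + 1) y := by
    have hexp := Real.hasDerivAt_exp y
    refine HasDerivAt.congr_deriv ((((hasDerivAt_id' y).mul (hexp.add_const 1)).sub
      (hexp.const_mul 2)).add_const 2) ?_
    ring
  have hmono : StrictMonoOn (fun y : ℝ => y * (Real.exp y + 1) - 2 * Real.exp y + 2)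
      (Set.Ici 0) := by
    refine strictMonoOn_of_deriv_pos (convex_Ici 0)
      (fun y _ => (hd y).continuousAt.continuousWithinAt) fun y hy => ?_
    rw [interior_Ici] at hy
    rw [(hd y).deriv]
    have h := Real.add_one_lt_exp (neg_ne_zero.mpr (ne_of_gt hy))
    have hinv : Real.exp (-y) * Real.exp y = 1 := by rw [← Real.exp_add]; simp
    nlinarith [Real.exp_pos y]
  have h := hmono Set.self_mem_Ici hx.le hx
  simp only [Real.exp_zero] at h
  linarith

/-- A function vanishing at `a` with positive derivative there is positive just to the right. -/
theorem HasDerivAt.eventually_pos_nhdsGT {f : ℝ → ℝ} {a f' : ℝ} (hf : HasDerivAt f f' a)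
    (ha : f a = 0) (hf' : 0 < f') : ∀ᶠ x in nhdsWithin a (Set.Ioi a), 0 < f x := by
  have h := (hasDerivAt_iff_tendsto_slope.mp hf).mono_left
    (nhdsWithin_mono a fun x (hx : a < x) => ne_of_gt hx)
  filter_upwards [h.eventually (lt_mem_nhds hf'), self_mem_nhdsWithin] with x hx hax
  rw [slope_def_field, ha, sub_zero] at hx
  exact (div_pos_iff_of_pos_right (sub_pos.mpr hax)).mp hx

/-- If `N > 0` near `1`, then `log (N α / N 1)` beats `c * α * (α - 1)` just to the right of `1`
as soon as the two have the same slope at `1` and the former has the larger second derivative. -/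
theorem exists_gt_one_mul_lt_log_div {N N' : ℝ → ℝ} {c N'' : ℝ}
    (hN : ∀ x, HasDerivAt N (N' x) x) (hN' : HasDerivAt N' N'' 1) (hpos : 0 < N 1)
    (h1 : N' 1 = c * N 1) (h2 : 2 * c * N 1 + c * N' 1 < N'') :
    ∃ α, 1 < α ∧ c * (α * (α - 1)) < Real.log (N α / N 1) := by
  have hlin (x : ℝ) : HasDerivAt (fun x : ℝ => c * (2 * x - 1)) (2 * c) x := by
    refine HasDerivAt.congr_deriv ((((hasDerivAt_id' x).const_mul 2).sub_const 1).const_mul c) ?_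
    ring
  have hnum : HasDerivAt (fun x => N' x - c * (2 * x - 1) * N x)
      (N'' - (2 * c * N 1 + c * (2 * 1 - 1) * N' 1)) 1 :=
    hN'.sub ((hlin 1).mul (hN 1))
  have hnum_pos := hnum.eventually_pos_nhdsGT (by rw [h1]; ring) (by linarith)
  have hN_pos : ∀ᶠ x in nhdsWithin 1 (Set.Ioi 1), 0 < N x :=
    ((hN 1).continuousAt.eventually (lt_mem_nhds hpos)).filter_mono nhdsWithin_le_nhds
  obtain ⟨b, hb, hball⟩ := mem_nhdsGT_iff_exists_Ioc_subset.mp (hnum_pos.and hN_pos)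
  have hNb : ∀ x ∈ Set.Icc 1 b, 0 < N x := fun x hx => by
    rcases hx.1.eq_or_lt with rfl | h
    · exact hpos
    · exact (hball ⟨h, hx.2⟩).2
  have hg : ∀ x ∈ Set.Icc 1 b, HasDerivAt (fun x => Real.log (N x) - c * (x * (x - 1)))
      (N' x / N x - c * (2 * x - 1)) x := fun x hx => by
    refine HasDerivAt.congr_deriv (((hN x).log (hNb x hx).ne').sub
      (((hasDerivAt_id' x).mul ((hasDerivAt_id' x).sub_const 1)).const_mul c)) ?_
    ring
  have hmono : StrictMonoOn (fun x => Real.log (N x) - c * (x * (x - 1))) (Set.Icc 1 b) := by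
    refine strictMonoOn_of_deriv_pos (convex_Icc 1 b)
      (fun x hx => (hg x hx).continuousAt.continuousWithinAt) fun x hx => ?_
    rw [interior_Icc] at hx
    rw [(hg x (Set.Ioo_subset_Icc_self hx)).deriv, sub_pos,
      lt_div_iff₀ (hNb x (Set.Ioo_subset_Icc_self hx))]
    exact sub_pos.mp (hball (Set.Ioo_subset_Ioc_self hx)).1
  have hb' : (1 : ℝ) ≤ b := le_of_lt hb
  have h := hmono (Set.left_mem_Icc.mpr hb') (Set.right_mem_Icc.mpr hb') hb
  refine ⟨b, hb, ?_⟩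
  rw [Real.log_div (hNb b (Set.right_mem_Icc.mpr hb')).ne' hpos.ne']
  simp only [sub_self, mul_zero, sub_zero] at h
  linarith

/-- For k above the threshold k*(ε), the ε-DP k-RR mechanism is **not**
(ε·(e^ε−1)/(e^ε−1+k))-zCDP. -/
theorem kRR_not_zCDP (ε : ℝ) (hε : 0 < ε) (k : ℝ)
    (hk : k > 2 * (Real.exp ε - 1) * (Real.exp ε - 1 - ε)
            / (ε * (Real.exp ε + 1) - 2 * Real.exp ε + 2)) :
    ∃ α : ℝ, 1 < α ∧
      (1 / (α * (α - 1))) *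
        Real.log ((Real.exp (α * ε) + Real.exp ((1 - α) * ε) + k - 2)
          / (k - 1 + Real.exp ε))
        > ε * (Real.exp ε - 1) / (Real.exp ε - 1 + k) := by
  have hD := exp_trapezoid_pos hε
  have hE := Real.add_one_lt_exp hε.ne'
  have hk_pos : 0 < k := lt_of_le_of_lt
    (div_nonneg (mul_nonneg (by linarith) (by linarith)) hD.le) hk
  have hS : 0 < Real.exp ε - 1 + k := by linarith
  rw [gt_iff_lt, div_lt_iff₀ hD] at hk
  have hexp₁ (x : ℝ) : HasDerivAt (fun x => Real.exp (x * ε)) (ε * Real.exp (x * ε)) x := by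
    refine HasDerivAt.congr_deriv (((hasDerivAt_id' x).mul_const ε).exp) ?_
    ring
  have hexp₂ (x : ℝ) : HasDerivAt (fun x => Real.exp ((1 - x) * ε))
      (-(ε * Real.exp ((1 - x) * ε))) x := by
    refine HasDerivAt.congr_deriv ((((hasDerivAt_id' x).const_sub 1).mul_const ε).exp) ?_
    ring
  have hN (x : ℝ) : HasDerivAt (fun x => Real.exp (x * ε) + Real.exp ((1 - x) * ε) + k - 2)
      (ε * Real.exp (x * ε) - ε * Real.exp ((1 - x) * ε)) x :=
    (((hexp₁ x).add (hexp₂ x)).add_const k).sub_const 2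
  have hN' := ((hexp₁ 1).const_mul ε).sub ((hexp₂ 1).const_mul ε)
  have hN1 : Real.exp (1 * ε) + Real.exp ((1 - 1) * ε) + k - 2 = Real.exp ε - 1 + k := by
    simp only [one_mul, sub_self, zero_mul, Real.exp_zero]
    ring
  obtain ⟨α, hα, h⟩ := exists_gt_one_mul_lt_log_div
    (c := ε * (Real.exp ε - 1) / (Real.exp ε - 1 + k)) hN hN' (by rw [hN1]; exact hS)
    (by
      rw [hN1, div_mul_cancel₀ _ hS.ne']
      simp only [one_mul, sub_self, zero_mul, Real.exp_zero]
      ring)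
    (by
      rw [hN1, mul_assoc, div_mul_cancel₀ _ hS.ne']
      simp only [one_mul, sub_self, zero_mul, Real.exp_zero]
      rw [← lt_sub_iff_add_lt', div_mul_eq_mul_div, div_lt_iff₀ hS]
      nlinarith [mul_lt_mul_of_pos_left hk hε])
  refine ⟨α, hα, ?_⟩
  rw [hN1, show Real.exp ε - 1 + k = k - 1 + Real.exp ε by ring] at h
  rw [gt_iff_lt, one_div_mul_eq_div, lt_div_iff₀ (mul_pos (by linarith) (by linarith)),
    show Real.exp ε - 1 + k = k - 1 + Real.exp ε by ring]
  exact h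
end

section
/- For all real ε > 0, 6·(ε·(exp(ε)+1) − 2·exp(ε) + 2) ≤ 2·(exp(ε)−1)·(exp(ε)−1−ε). (Equivalently, since ε·(e^ε+1) − 2e^ε + 2 > 0 for ε > 0, the threshold k*(ε) = 2(e^ε−1)(e^ε−1−ε)/(ε(e^ε+1) − 2e^ε + 2) is at least 6 for every ε > 0.) -/
open Real in
/-- The difference of the two sides of the threshold inequality (halved) is monotone on `[0, ∞)`,
since its derivative is `4 * exp x * (sinh x - x)`. -/
theorem monotoneOn_exp_sq_add_four_mul_exp_sub :
    MonotoneOn (fun x : ℝ => exp x ^ 2 + 4 * exp x - 5 - 4 * x * exp x - 2 * x) (Set.Ici 0) := by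
  have hderiv (x : ℝ) :
      HasDerivAt (fun x : ℝ => exp x ^ 2 + 4 * exp x - 5 - 4 * x * exp x - 2 * x)
        (4 * exp x * (sinh x - x)) x := by
    have hE := hasDerivAt_exp x
    have hx := hasDerivAt_id' x
    have hmul : exp x * exp (-x) = 1 := by rw [← exp_add, add_neg_cancel, exp_zero]
    refine (((((hE.pow 2).add (hE.const_mul 4)).sub_const 5).sub
      ((hx.const_mul 4).mul hE)).sub (hx.const_mul 2)).congr_deriv ?_
    rw [sinh_eq]
    push_cast
    linear_combination 2 * hmul
  refine monotoneOn_of_hasDerivWithinAt_nonneg (convex_Ici 0)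
    (fun x _ => (hderiv x).continuousAt.continuousWithinAt)
    (fun x _ => (hderiv x).hasDerivWithinAt) fun x hx => ?_
  rw [interior_Ici] at hx
  exact mul_nonneg (by positivity) (sub_nonneg.2 (self_le_sinh_iff.2 (le_of_lt hx)))

/-- Key inequality showing the k-RR threshold k*(ε) is at least 6 for every ε > 0. -/
theorem kRR_threshold_ge_six (ε : ℝ) (hε : 0 < ε) :
    6 * (ε * (Real.exp ε + 1) - 2 * Real.exp ε + 2)
      ≤ 2 * (Real.exp ε - 1) * (Real.exp ε - 1 - ε) := by
  have h := monotoneOn_exp_sq_add_four_mul_exp_sub Set.self_mem_Ici (Set.mem_Ici.2 hε.le) hε.le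
  norm_num at h
  linarith
end

section
/- For all real ε > 0 and all real α > 1, (2/(α·(α−1))) · log( (exp(α·ε/2) + exp((1−α)·ε/2)) / (exp(ε/2) + 1) ) ≤ ε · tanh(ε/4). (This states that the ε-DP RAPPOR mechanism is (ε·tanh(ε/4))-zCDP.) -/
/-- `t ↦ sinh t / t` is monotone on the nonnegative reals, with denominators cleared. -/
theorem mul_sinh_le_mul_sinh_s10 {d s : ℝ} (hd : 0 ≤ d) (hds : d ≤ s) :
    s * Real.sinh d ≤ d * Real.sinh s := by
  rcases (hd.trans hds).eq_or_lt with rfl | hs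
  · simp [le_antisymm hds hd]
  have hl : d / s ≤ 1 := div_le_one_of_le₀ hds hs.le
  have hl0 : 0 ≤ d / s := by positivity
  have hderiv (t : ℝ) : HasDerivAt (fun t => d / s * Real.sinh t - Real.sinh (d / s * t))
      (d / s * Real.cosh t - Real.cosh (d / s * t) * (d / s)) t := by
    have h := ((hasDerivAt_id t).const_mul (d / s)).sinh
    simp only [id, mul_one] at h
    exact ((Real.hasDerivAt_sinh t).const_mul (d / s)).sub h
  have hmono : MonotoneOn (fun t => d / s * Real.sinh t - Real.sinh (d / s * t)) (Set.Ici 0) := by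
    refine monotoneOn_of_deriv_nonneg (convex_Ici 0)
      (fun t _ => (hderiv t).continuousAt.continuousWithinAt)
      (fun t _ => (hderiv t).differentiableAt.differentiableWithinAt) fun t ht => ?_
    rw [interior_Ici, Set.mem_Ioi] at ht
    rw [(hderiv t).deriv]
    have hcosh : Real.cosh (d / s * t) ≤ Real.cosh t := by
      rw [Real.cosh_le_cosh, abs_of_nonneg (by positivity), abs_of_pos ht]
      exact mul_le_of_le_one_left ht.le hl
    nlinarith
  have h := hmono (Set.mem_Ici.2 le_rfl) (Set.mem_Ici.2 hs.le) hs.le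
  simp only [Real.sinh_zero, mul_zero, sub_zero, div_mul_cancel₀ d hs.ne'] at h
  have hmul := mul_le_mul_of_nonneg_left (sub_nonneg.1 h) hs.le
  rwa [← mul_assoc, mul_div_cancel₀ d hs.ne'] at hmul

/-- `t ↦ tanh t / t` is antitone on the positive reals, with denominators cleared. -/
theorem mul_tanh_le_mul_tanh {u x : ℝ} (hu : 0 ≤ u) (hux : u ≤ x) :
    u * Real.tanh x ≤ x * Real.tanh u := by
  have h := mul_sinh_le_mul_sinh_s10 (sub_nonneg.2 hux) (show x - u ≤ x + u by linarith)
  rw [Real.sinh_sub, Real.sinh_add] at h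
  rw [Real.tanh_eq_sinh_div_cosh, Real.tanh_eq_sinh_div_cosh, ← mul_div_assoc, ← mul_div_assoc,
    div_le_div_iff₀ (Real.cosh_pos x) (Real.cosh_pos u)]
  linarith

/-- The quadratic upper bound on `log ∘ cosh` that is tangent at `u`. -/
theorem log_cosh_sub_log_cosh_le {u x : ℝ} (hu : 0 < u) (hux : u ≤ x) :
    Real.log (Real.cosh x) - Real.log (Real.cosh u) ≤
      (x ^ 2 - u ^ 2) / 2 * (Real.tanh u / u) := by
  have hderiv (t : ℝ) : HasDerivAt
      (fun t => t ^ 2 / 2 * (Real.tanh u / u) - Real.log (Real.cosh t))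
      (t * (Real.tanh u / u) - Real.tanh t) t := by
    have hsq := ((hasDerivAt_pow 2 t).div_const 2).mul_const (Real.tanh u / u)
    have hlog := (Real.hasDerivAt_cosh t).log (Real.cosh_pos t).ne'
    refine (hsq.sub hlog).congr_deriv ?_
    rw [Real.tanh_eq_sinh_div_cosh t]
    simp
  have hmono : MonotoneOn (fun t => t ^ 2 / 2 * (Real.tanh u / u) - Real.log (Real.cosh t))
      (Set.Ici u) := by
    refine monotoneOn_of_deriv_nonneg (convex_Ici u)
      (fun t _ => (hderiv t).continuousAt.continuousWithinAt)
      (fun t _ => (hderiv t).differentiableAt.differentiableWithinAt) fun t ht => ?_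
    rw [interior_Ici, Set.mem_Ioi] at ht
    rw [(hderiv t).deriv, sub_nonneg, ← mul_div_assoc, le_div_iff₀ hu, mul_comm]
    exact mul_tanh_le_mul_tanh hu.le ht.le
  have h := hmono (Set.mem_Ici.2 le_rfl) (Set.mem_Ici.2 hux) hux
  simp only at h
  linarith

/-- Factoring `exp ((a + b) / 2)` out of `exp a + exp b`. -/
theorem exp_add_exp_eq (a b : ℝ) :
    Real.exp a + Real.exp b = 2 * Real.exp ((a + b) / 2) * Real.cosh ((a - b) / 2) := by
  have ha : Real.exp a = Real.exp ((a + b) / 2) * Real.exp ((a - b) / 2) := by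
    rw [← Real.exp_add]; ring_nf
  have hb : Real.exp b = Real.exp ((a + b) / 2) * Real.exp (-((a - b) / 2)) := by
    rw [← Real.exp_add]; ring_nf
  rw [Real.cosh_eq, ha, hb]
  ring


/-- The ε-DP RAPPOR mechanism is (ε·tanh(ε/4))-zCDP. -/
theorem rappor_zCDP (ε : ℝ) (hε : 0 < ε) (α : ℝ) (hα : 1 < α) :
    (2 / (α * (α - 1))) *
      Real.log ((Real.exp (α * ε / 2) + Real.exp ((1 - α) * ε / 2))
        / (Real.exp (ε / 2) + 1))
      ≤ ε * Real.tanh (ε / 4) := by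
  have hα' : 0 < α - 1 := sub_pos.2 hα
  have hratio : (Real.exp (α * ε / 2) + Real.exp ((1 - α) * ε / 2)) / (Real.exp (ε / 2) + 1) =
      Real.cosh ((2 * α - 1) * (ε / 4)) / Real.cosh (ε / 4) := by
    have hden := exp_add_exp_eq (ε / 2) 0
    rw [Real.exp_zero] at hden
    rw [exp_add_exp_eq, hden,
      show (α * ε / 2 + (1 - α) * ε / 2) / 2 = (ε / 2 + 0) / 2 by ring,
      show (α * ε / 2 - (1 - α) * ε / 2) / 2 = (2 * α - 1) * (ε / 4) by ring,
      show (ε / 2 - 0) / 2 = ε / 4 by ring]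
    exact mul_div_mul_left _ _ (by positivity)
  rw [hratio, Real.log_div (Real.cosh_pos _).ne' (Real.cosh_pos _).ne']
  calc
    _ ≤ 2 / (α * (α - 1)) * ((((2 * α - 1) * (ε / 4)) ^ 2 - (ε / 4) ^ 2) / 2 *
        (Real.tanh (ε / 4) / (ε / 4))) := by
      gcongr
      exact log_cosh_sub_log_cosh_le (by positivity) (by nlinarith)
    _ = ε * Real.tanh (ε / 4) := by
      field_simp
      ring
end

section
/- Let η > 0 and t be real numbers with 0 ≤ t ≤ η, let α > 1 be real, and let P and Q be probability mass functions on a countable type X such that for every x with Q(x) > 0, exp(−t) ≤ P(x)/Q(x) ≤ exp(η − t), and P(x) = 0 whenever Q(x) = 0. Then ∑_{x ∈ X} P(x)^α · Q(x)^{1−α} ≤ ( (exp(η) − exp(t))·exp(−t·α) + (exp(t) − 1)·exp((η − t)·α) ) / (exp(η) − 1). Consequently the Rényi divergence D_α(P‖Q) = (1/(α−1))·log( ∑_x P(x)^α Q(x)^{1−α} ) is at most ε̂_BR(t; α) := (1/(α−1))·log( ((e^η − e^t)/(e^η − 1))·e^{−tα} + ((e^t − 1)/(e^η − 1))·e^{(η−t)α}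 ). -/
/-- The chord bound for a convex function, with denominators cleared. -/
theorem ConvexOn.sub_mul_le_chord {s : Set ℝ} {f : ℝ → ℝ} (hf : ConvexOn ℝ s f) {a b r : ℝ}
    (ha : a ∈ s) (hb : b ∈ s) (hab : a < b) (har : a ≤ r) (hrb : r ≤ b) :
    (b - a) * f r ≤ (b - r) * f a + (r - a) * f b := by
  have hd : 0 < b - a := sub_pos.2 hab
  have h := hf.2 ha hb (div_nonneg (sub_nonneg.2 hrb) hd.le)
    (div_nonneg (sub_nonneg.2 har) hd.le) (by field_simp; ring)
  have hr : ((b - r) / (b - a)) • a + ((r - a) / (b - a)) • b = r := by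
    simp only [smul_eq_mul]; field_simp; ring
  rw [hr] at h
  calc (b - a) * f r ≤ (b - a) * (((b - r) / (b - a)) • f a + ((r - a) / (b - a)) • f b) :=
        mul_le_mul_of_nonneg_left h hd.le
    _ = (b - r) * f a + (r - a) * f b := by
        simp only [smul_eq_mul]; field_simp

/-- If `p / q ∈ [a, b]`, the Rényi summand `p ^ α * q ^ (1 - α)` is at most the value at `(p, q)`
of the linear form interpolating it on the rays `p = a * q` and `p = b * q`. -/
theorem rpow_mul_rpow_one_sub_le {α a b p q : ℝ} (hα : 1 ≤ α) (ha : 0 ≤ a) (hab : a < b)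
    (hp : 0 ≤ p) (hq : 0 < q) (hap : a ≤ p / q) (hpb : p / q ≤ b) :
    p ^ α * q ^ (1 - α) ≤ ((b * q - p) * a ^ α + (p - a * q) * b ^ α) / (b - a) := by
  have h := (convexOn_rpow hα).sub_mul_le_chord ha (ha.trans hab.le) hab hap hpb
  have he : p ^ α * q ^ (1 - α) = q * (p / q) ^ α := by
    rw [Real.div_rpow hp hq.le, Real.rpow_sub hq, Real.rpow_one]
    ring
  rw [he, le_div_iff₀ (sub_pos.2 hab)]
  calc q * (p / q) ^ α * (b - a) = q * ((b - a) * (p / q) ^ α) := by ring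
    _ ≤ q * ((b - p / q) * a ^ α + (p / q - a) * b ^ α) := mul_le_mul_of_nonneg_left h hq.le
    _ = (b * q - p) * a ^ α + (p - a * q) * b ^ α := by field_simp


/-- Rényi divergence bound for bounded range mechanisms: if the likelihood ratio
P(x)/Q(x) lies in [e^{−t}, e^{η−t}] on the support of Q (and P ≪ Q), then both
the power sum and the order-α Rényi divergence are bounded by the worst case. -/
theorem br_renyi_bound {X : Type*} [Countable X] (η t : ℝ) (hη : 0 < η)
    (ht0 : 0 ≤ t) (htη : t ≤ η) (α : ℝ) (hα : 1 < α)
    (P Q : X → ℝ) (hP0 : ∀ x, 0 ≤ P x) (hQ0 : ∀ x, 0 ≤ Q x)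
    (hPsum : HasSum P 1) (hQsum : HasSum Q 1)
    (hratio : ∀ x, 0 < Q x → Real.exp (-t) ≤ P x / Q x ∧ P x / Q x ≤ Real.exp (η - t))
    (habs : ∀ x, Q x = 0 → P x = 0) :
    (∑' x, P x ^ α * Q x ^ (1 - α))
        ≤ ((Real.exp η - Real.exp t) * Real.exp (-t * α)
            + (Real.exp t - 1) * Real.exp ((η - t) * α)) / (Real.exp η - 1)
    ∧ (1 / (α - 1)) * Real.log (∑' x, P x ^ α * Q x ^ (1 - α))
        ≤ (1 / (α - 1)) *
            Real.log (((Real.exp η - Real.exp t) / (Real.exp η - 1)) * Real.exp (-t * α)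
              + ((Real.exp t - 1) / (Real.exp η - 1)) * Real.exp ((η - t) * α)) := by
  have hab : Real.exp (-t) < Real.exp (η - t) := Real.exp_lt_exp.2 (by linarith)
  have hη1 : 0 < Real.exp η - 1 := sub_pos.2 (Real.one_lt_exp_iff.2 hη)
  have hterm : ∀ x, P x ^ α * Q x ^ (1 - α) ≤
      ((Real.exp (η - t) * Q x - P x) * Real.exp (-t) ^ α
        + (P x - Real.exp (-t) * Q x) * Real.exp (η - t) ^ α)
          / (Real.exp (η - t) - Real.exp (-t)) := by
    intro x
    rcases (hQ0 x).eq_or_lt' with hq | hq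
    · simp [hq, habs x hq, Real.zero_rpow (by linarith : α ≠ 0)]
    · exact rpow_mul_rpow_one_sub_le hα.le (Real.exp_pos _).le hab (hP0 x) hq
        (hratio x hq).1 (hratio x hq).2
  have hnonneg : ∀ x, 0 ≤ P x ^ α * Q x ^ (1 - α) := fun x =>
    mul_nonneg (Real.rpow_nonneg (hP0 x) _) (Real.rpow_nonneg (hQ0 x) _)
  have hbound := (((((hQsum.mul_left (Real.exp (η - t))).sub hPsum).mul_right
    (Real.exp (-t) ^ α)).add ((hPsum.sub (hQsum.mul_left (Real.exp (-t)))).mul_right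
      (Real.exp (η - t) ^ α))).div_const (Real.exp (η - t) - Real.exp (-t)))
  have hsum : Summable fun x => P x ^ α * Q x ^ (1 - α) :=
    hbound.summable.of_nonneg_of_le hnonneg hterm
  have hle : (∑' x, P x ^ α * Q x ^ (1 - α))
      ≤ ((Real.exp η - Real.exp t) * Real.exp (-t * α)
          + (Real.exp t - 1) * Real.exp ((η - t) * α)) / (Real.exp η - 1) := by
    refine (hasSum_le hterm hsum.hasSum hbound).trans_eq ?_
    rw [div_eq_div_iff (sub_pos.2 hab).ne' hη1.ne', ← Real.exp_mul, ← Real.exp_mul,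
      Real.exp_sub, Real.exp_neg]
    field_simp
  refine ⟨hle, ?_⟩
  have hpos : 0 < ∑' x, P x ^ α * Q x ^ (1 - α) := by
    obtain ⟨x, hx⟩ : ∃ x, Q x ≠ 0 := by
      by_contra! h
      exact one_ne_zero (hQsum.unique (by simp [funext h]))
    have hq : 0 < Q x := (hQ0 x).lt_of_ne' hx
    have hp : 0 < P x := by
      have := (Real.exp_pos _).trans_le (hratio x hq).1
      exact (div_pos_iff_of_pos_right hq).1 this
    exact hsum.tsum_pos hnonneg x (mul_pos (Real.rpow_pos_of_pos hp _) (Real.rpow_pos_of_pos hq _))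
  refine mul_le_mul_of_nonneg_left (Real.log_le_log hpos (hle.trans_eq ?_))
    (one_div_nonneg.2 (by linarith))
  ring
end

section
/- For all real η > 0, the limit as α → 1⁺ of (1/(α−1)) · log( (exp(α·η) − 1)^α · ( α·(exp(α·η) − exp(η))/(α−1) )^{1−α} / ( α·(exp(η) − 1) ) ) equals η/(exp(η) − 1) + log((exp(η) − 1)/η) − 1. -/
open Filter

/-- The limit as α → 1⁺ of the tight RDP curve ε̂_BR(α) for η-bounded range
mechanisms equals η/(e^η − 1) + log((e^η − 1)/η) − 1. -/
theorem br_rdp_limit (η : ℝ) (hη : 0 < η) :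
    Tendsto (fun α : ℝ =>
        (1 / (α - 1)) *
          Real.log ((Real.exp (α * η) - 1) ^ α *
            (α * (Real.exp (α * η) - Real.exp η) / (α - 1)) ^ (1 - α)
            / (α * (Real.exp η - 1))))
      (nhdsWithin 1 (Set.Ioi 1))
      (nhds (η / (Real.exp η - 1) + Real.log ((Real.exp η - 1) / η) - 1)) := by
  have hD : 0 < Real.exp η - 1 := sub_pos.2 (Real.one_lt_exp_iff.2 hη)
  have hexp : HasDerivAt (fun α : ℝ => Real.exp (α * η)) (Real.exp η * η) 1 := by
    simpa using ((hasDerivAt_id (1 : ℝ)).mul_const η).exp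
  have hlog : HasDerivAt (fun α : ℝ => α * Real.log (Real.exp (α * η) - 1) - Real.log α)
      (Real.log (Real.exp η - 1) + Real.exp η * η / (Real.exp η - 1) - 1) 1 := by
    have h := ((hasDerivAt_id (1 : ℝ)).mul ((hexp.sub_const 1).log (by simpa using hD.ne'))).sub
      (Real.hasDerivAt_log one_ne_zero)
    refine (h.congr_deriv ?_ :)
    simp
  have hle : nhdsWithin (1 : ℝ) (Set.Ioi 1) ≤ nhdsWithin 1 {1}ᶜ :=
    nhdsWithin_mono _ fun x (hx : 1 < x) => hx.ne'
  have hslope_exp := hexp.tendsto_slope.mono_left hle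
  have hslope_log := hlog.tendsto_slope.mono_left hle
  have hid : Tendsto (fun α : ℝ => α) (nhdsWithin 1 (Set.Ioi 1)) (nhds 1) :=
    tendsto_id.mono_left nhdsWithin_le_nhds
  have hlim := hslope_log.sub ((hid.mul hslope_exp).log (by positivity))
  have hval : Real.log (Real.exp η - 1) + Real.exp η * η / (Real.exp η - 1) - 1
      - Real.log (1 * (Real.exp η * η))
      = η / (Real.exp η - 1) + Real.log ((Real.exp η - 1) / η) - 1 := by
    rw [one_mul, Real.log_mul (Real.exp_pos η).ne' hη.ne', Real.log_exp,
      Real.log_div hD.ne' hη.ne']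
    field_simp
    ring
  rw [hval] at hlim
  refine hlim.congr' ?_
  filter_upwards [self_mem_nhdsWithin] with α (hα : 1 < α)
  have hα0 : 0 < α := by linarith
  have hα1 : 0 < α - 1 := sub_pos.2 hα
  have hA : 0 < Real.exp (α * η) - 1 := sub_pos.2 (Real.one_lt_exp_iff.2 (by positivity))
  have hB : 0 < α * (Real.exp (α * η) - Real.exp η) / (α - 1) := by
    have : 0 < Real.exp (α * η) - Real.exp η :=
      sub_pos.2 (Real.exp_lt_exp.2 (by nlinarith))
    positivity
  have hAα := Real.rpow_pos_of_pos hA α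
  have hBα := Real.rpow_pos_of_pos hB (1 - α)
  simp only [slope_def_field, one_mul, Real.log_one, sub_zero]
  rw [Real.log_div (mul_pos hAα hBα).ne' (mul_pos hα0 hD).ne', Real.log_mul hAα.ne' hBα.ne',
    Real.log_rpow hA, Real.log_rpow hB, Real.log_mul hα0.ne' hD.ne', ← mul_div_assoc]
  generalize Real.log (α * (Real.exp (α * η) - Real.exp η) / (α - 1)) = L
  field_simp
  ring
end

section
/- For all real η > 0 and all real α > 1, (1/(α·(α−1))) · log( (exp(α·η) − 1)^α · ( α·(exp(α·η) − exp(η))/(α−1) )^{1−α} / ( α·(exp(η) − 1) ) ) ≤ η/(exp(η) − 1) + log((exp(η) − 1)/η) − 1. (This states that every η-bounded range mechanism is ρ-zCDP with ρ = η/(e^η−1) + log((e^η−1)/η) − 1.) -/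
namespace BoundedRange

open Filter Topology Set

lemma sinh_le_mul_cosh {u : ℝ} (hu : 0 < u) : Real.sinh u ≤ u * Real.cosh u := by
  have hmono : MonotoneOn (fun x : ℝ => x * Real.cosh x - Real.sinh x) (Ici 0) := by
    refine monotoneOn_of_hasDerivWithinAt_nonneg (f' := fun x => x * Real.sinh x)
      (convex_Ici 0) (by fun_prop) (fun x _ => ?_) (fun x hx => ?_)
    · have h := ((hasDerivAt_id x).mul (Real.hasDerivAt_cosh x)).sub (Real.hasDerivAt_sinh x)
      refine (h.congr_deriv ?_).hasDerivWithinAt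
      simp
    · rw [interior_Ici] at hx
      exact mul_nonneg (le_of_lt hx) (Real.sinh_nonneg_iff.2 (le_of_lt hx))
  have h := hmono self_mem_Ici (mem_Ici.2 hu.le) hu.le
  simp only [zero_mul, Real.sinh_zero, sub_zero] at h
  linarith

/-- A nondecreasing function on `(0, ∞)` is nonnegative if it is bounded below by a function
tending to `0` at `0`. -/
lemma nonneg_of_monotoneOn_of_tendsto {φ ψ : ℝ → ℝ} (hφ : MonotoneOn φ (Ioi 0))
    (hle : ∀ y > 0, ψ y ≤ φ y) (hψ : Tendsto ψ (𝓝[>] 0) (𝓝 0)) {y : ℝ} (hy : 0 < y) :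
    0 ≤ φ y := by
  refine le_of_tendsto hψ ?_
  filter_upwards [Ioo_mem_nhdsGT hy] with x hx
  exact (hle x hx.1).trans (hφ hx.1 hy hx.2.le)

lemma monotoneOn_Ioi_of_hasDerivAt_nonneg {f f' : ℝ → ℝ}
    (hf : ∀ x > 0, HasDerivAt f (f' x) x) (hf' : ∀ x > 0, 0 ≤ f' x) :
    MonotoneOn f (Ioi 0) := by
  refine monotoneOn_of_hasDerivWithinAt_nonneg (f' := f') (convex_Ioi 0)
    (fun x hx => (hf x hx).continuousAt.continuousWithinAt) (fun x hx => ?_) (fun x hx => ?_)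
  · rw [interior_Ioi] at hx
    exact (hf x hx).hasDerivWithinAt
  · rw [interior_Ioi] at hx
    exact hf' x hx

/-- `u ↦ u log (sinh u / u)`. -/
noncomputable def mulLogSinhc (u : ℝ) : ℝ := u * Real.log (Real.sinh u / u)

/-- The first derivative of `mulLogSinhc`. -/
noncomputable def mulLogSinhcDeriv (u : ℝ) : ℝ :=
  Real.log (Real.sinh u / u) + u * Real.cosh u / Real.sinh u - 1

/-- The second derivative of `mulLogSinhc`. -/
noncomputable def mulLogSinhcDeriv₂ (u : ℝ) : ℝ :=
  2 * (Real.cosh u / Real.sinh u) - 1 / u - u / Real.sinh u ^ 2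

lemma one_le_sinh_div {u : ℝ} (hu : 0 < u) : 1 ≤ Real.sinh u / u :=
  (one_le_div hu).2 (Real.self_le_sinh_iff.2 hu.le)

lemma hasDerivAt_log_sinh_div {u : ℝ} (hu : 0 < u) :
    HasDerivAt (fun x => Real.log (Real.sinh x / x)) (Real.cosh u / Real.sinh u - 1 / u) u := by
  have hs : 0 < Real.sinh u := Real.sinh_pos_iff.2 hu
  have h := ((Real.hasDerivAt_sinh u).div (hasDerivAt_id u) hu.ne').log
    (div_pos hs hu).ne'
  refine h.congr_deriv ?_
  simp only [id, Pi.div_apply]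
  field_simp

lemma hasDerivAt_mulLogSinhc {u : ℝ} (hu : 0 < u) :
    HasDerivAt mulLogSinhc (mulLogSinhcDeriv u) u := by
  have hs : 0 < Real.sinh u := Real.sinh_pos_iff.2 hu
  refine ((hasDerivAt_id u).mul (hasDerivAt_log_sinh_div hu)).congr_deriv ?_
  simp only [id, mulLogSinhcDeriv]
  field_simp
  ring

lemma hasDerivAt_mulLogSinhcDeriv {u : ℝ} (hu : 0 < u) :
    HasDerivAt mulLogSinhcDeriv (mulLogSinhcDeriv₂ u) u := by
  have hs : 0 < Real.sinh u := Real.sinh_pos_iff.2 hu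
  refine (((hasDerivAt_log_sinh_div hu).add
    (((hasDerivAt_id u).mul (Real.hasDerivAt_cosh u)).div (Real.hasDerivAt_sinh u)
      hs.ne')).sub_const 1).congr_deriv ?_
  simp only [id, mulLogSinhcDeriv₂, Pi.mul_apply]
  field_simp
  linear_combination (-u ^ 2) * Real.cosh_sq u

lemma hasDerivAt_mulLogSinhcDeriv₂ {u : ℝ} (hu : 0 < u) :
    HasDerivAt mulLogSinhcDeriv₂
      (1 / u ^ 2 - 3 / Real.sinh u ^ 2 + 2 * u * Real.cosh u / Real.sinh u ^ 3) u := by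
  have hs : 0 < Real.sinh u := Real.sinh_pos_iff.2 hu
  refine (((((Real.hasDerivAt_cosh u).div (Real.hasDerivAt_sinh u) hs.ne').const_mul 2).sub
    ((hasDerivAt_const u (1 : ℝ)).div (hasDerivAt_id u) hu.ne')).sub
    ((hasDerivAt_id u).div ((Real.hasDerivAt_sinh u).pow 2) (pow_pos hs 2).ne')).congr_deriv ?_
  simp only [id, Pi.pow_apply]
  field_simp
  have := Real.cosh_sq u
  grind

lemma mulLogSinhc_nonneg {u : ℝ} (hu : 0 < u) : 0 ≤ mulLogSinhc u :=
  mul_nonneg hu.le (Real.log_nonneg (one_le_sinh_div hu))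

lemma mulLogSinhcDeriv_nonneg {u : ℝ} (hu : 0 < u) : 0 ≤ mulLogSinhcDeriv u := by
  have hs : 0 < Real.sinh u := Real.sinh_pos_iff.2 hu
  have h₁ := Real.log_nonneg (one_le_sinh_div hu)
  have h₂ := (one_le_div hs).2 (sinh_le_mul_cosh hu)
  rw [mulLogSinhcDeriv]
  linarith

lemma mulLogSinhcDeriv₂_le {u : ℝ} (hu : 0 < u) :
    mulLogSinhcDeriv₂ u ≤ 2 / u * mulLogSinhcDeriv u := by
  have hs : 0 < Real.sinh u := Real.sinh_pos_iff.2 hu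
  have h := Real.one_sub_inv_le_log_of_pos (pow_pos (div_pos hs hu) 2)
  rw [Real.log_pow] at h
  push_cast at h
  have key : 2 / u * mulLogSinhcDeriv u - mulLogSinhcDeriv₂ u =
      (2 * Real.log (Real.sinh u / u) - (1 - ((Real.sinh u / u) ^ 2)⁻¹)) / u := by
    rw [mulLogSinhcDeriv, mulLogSinhcDeriv₂]
    field_simp
    ring
  have := div_nonneg (sub_nonneg.2 h) hu.le
  linarith

lemma mulLogSinhcDeriv₂_div_antitoneOn :
    AntitoneOn (fun u => mulLogSinhcDeriv₂ u / u) (Ioi 0) := by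
  have hmono : MonotoneOn (fun u => -(mulLogSinhcDeriv₂ u / u)) (Ioi 0) := by
    refine monotoneOn_Ioi_of_hasDerivAt_nonneg (fun u hu =>
      ((hasDerivAt_mulLogSinhcDeriv₂ hu).div (hasDerivAt_id u) hu.ne').neg) (fun u hu => ?_)
    have hs : 0 < Real.sinh u := Real.sinh_pos_iff.2 hu
    have key : 0 ≤ 2 * (Real.sinh u ^ 2 - u ^ 2) * (u * Real.cosh u - Real.sinh u) /
        (u ^ 3 * Real.sinh u ^ 3) := by
      refine div_nonneg (mul_nonneg (mul_nonneg zero_le_two ?_) ?_) (by positivity)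
      · exact sub_nonneg.2 (pow_le_pow_left₀ hu.le (Real.self_le_sinh_iff.2 hu.le) 2)
      · exact sub_nonneg.2 (sinh_le_mul_cosh hu)
    refine key.trans_eq ?_
    simp only [id, mulLogSinhcDeriv₂]
    field_simp
    ring
  intro x hx y hy hxy
  exact neg_le_neg_iff.1 (hmono hx hy hxy)

lemma mulLogSinhcDeriv₂_add_le {a b : ℝ} (ha : 0 < a) (hb : 0 < b) :
    mulLogSinhcDeriv₂ (a + b) ≤ mulLogSinhcDeriv₂ a + mulLogSinhcDeriv₂ b := by
  have hab := add_pos ha hb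
  have h₁ := mulLogSinhcDeriv₂_div_antitoneOn ha hab (le_add_of_nonneg_right hb.le)
  have h₂ := mulLogSinhcDeriv₂_div_antitoneOn hb hab (le_add_of_nonneg_left ha.le)
  simp only at h₁ h₂
  rw [le_div_iff₀ ha] at h₁
  rw [le_div_iff₀ hb] at h₂
  have h₃ : mulLogSinhcDeriv₂ (a + b) =
      mulLogSinhcDeriv₂ (a + b) / (a + b) * a + mulLogSinhcDeriv₂ (a + b) / (a + b) * b := by
    field_simp
  linarith

lemma tendsto_sub_shift {f : ℝ → ℝ} {a : ℝ} (hf : ContinuousAt f a) :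
    Tendsto (fun y => f a - f (y + a)) (𝓝[>] 0) (𝓝 0) := by
  have h : ContinuousAt (fun y => f a - f (y + a)) 0 :=
    continuousAt_const.sub (ContinuousAt.comp (g := f) (by simpa using hf) (by fun_prop))
  have h' := h.tendsto
  simp only [zero_add, sub_self] at h'
  exact h'.mono_left nhdsWithin_le_nhds

lemma mulLogSinhcDeriv_add_sub_le {a y : ℝ} (ha : 0 < a) (hy : 0 < y) :
    mulLogSinhcDeriv (y + a) - mulLogSinhcDeriv y ≤ (1 + 2 * y / a) * mulLogSinhcDeriv a := by
  refine sub_nonneg.1 (nonneg_of_monotoneOn_of_tendsto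
    (φ := fun y => (1 + 2 * y / a) * mulLogSinhcDeriv a -
      (mulLogSinhcDeriv (y + a) - mulLogSinhcDeriv y))
    (monotoneOn_Ioi_of_hasDerivAt_nonneg
      (f' := fun y => 2 / a * mulLogSinhcDeriv a -
        (mulLogSinhcDeriv₂ (y + a) - mulLogSinhcDeriv₂ y)) (fun y hy => ?_) (fun y hy => ?_))
    (fun y hy => ?_)
    (tendsto_sub_shift (hasDerivAt_mulLogSinhcDeriv ha).continuousAt) hy)
  · have h₁ := ((((hasDerivAt_id y).const_mul 2).div_const a).const_add 1).mul_const
      (mulLogSinhcDeriv a)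
    have h₂ := (hasDerivAt_mulLogSinhcDeriv (add_pos hy ha)).comp_add_const y a
    refine (h₁.sub (h₂.sub (hasDerivAt_mulLogSinhcDeriv hy))).congr_deriv ?_
    ring
  · have h₁ := mulLogSinhcDeriv₂_add_le hy ha
    have h₂ := mulLogSinhcDeriv₂_le ha
    linarith
  · have h₁ := mulLogSinhcDeriv_nonneg hy
    have h₂ : 0 ≤ 2 * y / a * mulLogSinhcDeriv a :=
      mul_nonneg (by positivity) (mulLogSinhcDeriv_nonneg ha)
    linarith

lemma mulLogSinhc_add_sub_le {a y : ℝ} (ha : 0 < a) (hy : 0 < y) :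
    mulLogSinhc (y + a) - mulLogSinhc y - mulLogSinhc a ≤
      (1 + y / a) * y * mulLogSinhcDeriv a := by
  refine sub_nonneg.1 (nonneg_of_monotoneOn_of_tendsto
    (φ := fun y => (1 + y / a) * y * mulLogSinhcDeriv a -
      (mulLogSinhc (y + a) - mulLogSinhc y - mulLogSinhc a))
    (monotoneOn_Ioi_of_hasDerivAt_nonneg
      (f' := fun y => (1 + 2 * y / a) * mulLogSinhcDeriv a -
        (mulLogSinhcDeriv (y + a) - mulLogSinhcDeriv y)) (fun y hy => ?_)
        (fun y hy => sub_nonneg.2 (mulLogSinhcDeriv_add_sub_le ha hy)))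
    (fun y hy => ?_)
    (tendsto_sub_shift (hasDerivAt_mulLogSinhc ha).continuousAt) hy)
  · have h₁ := ((((hasDerivAt_id y).div_const a).const_add 1).mul
      (hasDerivAt_id y)).mul_const (mulLogSinhcDeriv a)
    have h₂ := (hasDerivAt_mulLogSinhc (add_pos hy ha)).comp_add_const y a
    refine (h₁.sub ((h₂.sub (hasDerivAt_mulLogSinhc hy)).sub_const
      (mulLogSinhc a))).congr_deriv ?_
    simp only [id]
    ring
  · have h₁ := mulLogSinhc_nonneg hy
    have h₂ : 0 ≤ (1 + y / a) * y * mulLogSinhcDeriv a :=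
      mul_nonneg (by positivity) (mulLogSinhcDeriv_nonneg ha)
    linarith

lemma exp_two_mul_sub_one (u : ℝ) :
    Real.exp (2 * u) - 1 = 2 * Real.exp u * Real.sinh u := by
  rw [Real.sinh_eq, two_mul u, Real.exp_add, Real.exp_neg]
  field_simp

lemma log_exp_two_mul_sub_one {u : ℝ} (hu : 0 < u) :
    Real.log (Real.exp (2 * u) - 1) =
      Real.log 2 + u + Real.log u + Real.log (Real.sinh u / u) := by
  have hs : 0 < Real.sinh u := Real.sinh_pos_iff.2 hu
  rw [exp_two_mul_sub_one, Real.log_mul (by positivity) hs.ne',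
    Real.log_mul two_ne_zero (Real.exp_ne_zero u), Real.log_exp, Real.log_div hs.ne' hu.ne']
  ring

/-- The zCDP parameter of an `η`-bounded range mechanism, at `η = 2 * a`. -/
lemma mulLogSinhcDeriv_eq {a : ℝ} (ha : 0 < a) :
    mulLogSinhcDeriv a = 2 * a / (Real.exp (2 * a) - 1) +
      Real.log ((Real.exp (2 * a) - 1) / (2 * a)) - 1 := by
  have hs : 0 < Real.sinh a := Real.sinh_pos_iff.2 ha
  have hE : 0 < Real.exp (2 * a) - 1 := by
    rw [exp_two_mul_sub_one]
    positivity
  rw [Real.log_div hE.ne' (by positivity), log_exp_two_mul_sub_one ha,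
    Real.log_mul two_ne_zero ha.ne', exp_two_mul_sub_one, mulLogSinhcDeriv]
  have h : a * Real.cosh a / Real.sinh a = 2 * a / (2 * Real.exp a * Real.sinh a) + a := by
    have hc : Real.cosh a - Real.sinh a = (Real.exp a)⁻¹ := by
      rw [Real.cosh_sub_sinh, Real.exp_neg]
    rw [eq_add_of_sub_eq hc]
    field_simp
  rw [h]
  ring

/-- The logarithm in the order-`α` Rényi divergence bound, at `η = 2 * a`. -/
lemma log_divergence_eq {a α : ℝ} (ha : 0 < a) (hα : 1 < α) :
    Real.log ((Real.exp (α * (2 * a)) - 1) ^ α *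
        (α * (Real.exp (α * (2 * a)) - Real.exp (2 * a)) / (α - 1)) ^ (1 - α)
        / (α * (Real.exp (2 * a) - 1))) =
      (mulLogSinhc ((α - 1) * a + a) - mulLogSinhc ((α - 1) * a) - mulLogSinhc a) / a := by
  have hα₀ : 0 < α := one_pos.trans hα
  have hα₁ : 0 < α - 1 := sub_pos.2 hα
  have hE : ∀ {u : ℝ}, 0 < u → 0 < Real.exp (2 * u) - 1 := fun hu =>
    sub_pos.2 (Real.one_lt_exp_iff.2 (by positivity))
  have hαa : 0 < α * a := mul_pos hα₀ ha
  have hβa : 0 < (α - 1) * a := mul_pos hα₁ ha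
  have hsub : Real.exp (α * (2 * a)) - Real.exp (2 * a) =
      Real.exp (2 * a) * (Real.exp (2 * ((α - 1) * a)) - 1) := by
    rw [mul_sub, ← Real.exp_add, mul_one]
    ring_nf
  have h₁ := hE ha
  have h₂ := hE hαa
  have h₃ := hE hβa
  rw [hsub, show α * (2 * a) = 2 * (α * a) by ring, show (α - 1) * a + a = α * a by ring,
    Real.log_div (by positivity) (by positivity), Real.log_mul (by positivity) (by positivity),
    Real.log_rpow h₂, Real.log_rpow (by positivity), Real.log_div (by positivity) hα₁.ne',
    Real.log_mul hα₀.ne' (by positivity), Real.log_mul (by positivity) h₃.ne', Real.log_exp,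
    Real.log_mul hα₀.ne' h₁.ne', log_exp_two_mul_sub_one ha, log_exp_two_mul_sub_one hαa,
    log_exp_two_mul_sub_one hβa, Real.log_mul hα₀.ne' ha.ne', Real.log_mul hα₁.ne' ha.ne']
  simp only [mulLogSinhc]
  field_simp
  ring

end BoundedRange

/-- Every η-bounded range mechanism is ρ-zCDP with
ρ = η/(e^η−1) + log((e^η−1)/η) − 1. -/
theorem br_zCDP (η : ℝ) (hη : 0 < η) (α : ℝ) (hα : 1 < α) :
    (1 / (α * (α - 1))) *
      Real.log ((Real.exp (α * η) - 1) ^ α *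
        (α * (Real.exp (α * η) - Real.exp η) / (α - 1)) ^ (1 - α)
        / (α * (Real.exp η - 1)))
      ≤ η / (Real.exp η - 1) + Real.log ((Real.exp η - 1) / η) - 1 := by
  obtain ⟨a, rfl⟩ : ∃ a, η = 2 * a := ⟨η / 2, by ring⟩
  have ha : 0 < a := by linarith
  have hα₁ : 0 < α - 1 := sub_pos.2 hα
  have hα₀ : 0 < α := one_pos.trans hα
  rw [BoundedRange.log_divergence_eq ha hα, ← BoundedRange.mulLogSinhcDeriv_eq ha,
    one_div_mul_eq_div, div_div, div_le_iff₀ (by positivity)]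
  refine (BoundedRange.mulLogSinhc_add_sub_le ha (mul_pos hα₁ ha)).trans_eq ?_
  field_simp
  ring
end

section
/- For all real α > 1 and all real η > 0, (α−1)²·cosh(α·η) + 2·α − 1 ≥ α²·cosh((α−1)·η). -/
/-- Cross-multiplied form of the monotonicity of `sinh x / x` on the positive reals. -/
theorem mul_sinh_le_mul_sinh_s16 {x y : ℝ} (hx : 0 ≤ x) (hxy : x ≤ y) :
    y * Real.sinh x ≤ x * Real.sinh y := by
  rcases (hx.trans hxy).eq_or_lt with rfl | hy
  · simp [le_antisymm hxy hx]
  have h := convexOn_sinh_Ici.2 (Set.mem_Ici.2 le_rfl) (Set.mem_Ici.2 hy.le)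
    (sub_nonneg.2 ((div_le_one hy).2 hxy)) (div_nonneg hx hy.le) (sub_add_cancel 1 (x / y))
  simp only [smul_eq_mul, mul_zero, zero_add, Real.sinh_zero, div_mul_cancel₀ x hy.ne'] at h
  rwa [div_mul_eq_mul_div, le_div_iff₀' hy] at h

theorem cosh_eq_one_add_two_mul_sinh_half_sq (x : ℝ) :
    Real.cosh x = 1 + 2 * Real.sinh (x / 2) ^ 2 := by
  have h := Real.cosh_two_mul (x / 2)
  rw [Real.cosh_sq, mul_div_cancel₀ x two_ne_zero] at h
  linarith

/-- The inequality h₁(α, η) ≥ 0 from the bounded range zCDP analysis. -/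
theorem br_h1_nonneg (α : ℝ) (hα : 1 < α) (η : ℝ) (hη : 0 < η) :
    (α - 1) ^ 2 * Real.cosh (α * η) + 2 * α - 1 ≥ α ^ 2 * Real.cosh ((α - 1) * η) := by
  rw [cosh_eq_one_add_two_mul_sinh_half_sq (α * η),
    cosh_eq_one_add_two_mul_sinh_half_sq ((α - 1) * η)]
  have hx : 0 ≤ (α - 1) * η / 2 := by
    have := sub_pos.2 hα
    positivity
  have h : α * Real.sinh ((α - 1) * η / 2) ≤ (α - 1) * Real.sinh (α * η / 2) := by
    have := mul_sinh_le_mul_sinh_s16 hx (y := α * η / 2) (by linarith)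
    refine le_of_mul_le_mul_left ?_ (half_pos hη)
    linarith
  have hsq := pow_le_pow_left₀
    (mul_nonneg (by linarith) (Real.sinh_nonneg_iff.2 hx)) h 2
  linarith
end

section
/- For all real α > 1 and all real η > 0, α·(α−1)·η + sinh(α·η) ≤ coth(η/2)·(cosh(α·η) − 1). -/
theorem Real.mul_sinh_le_sinh_mul {a y : ℝ} (ha : 1 ≤ a) (hy : 0 ≤ y) :
    a * Real.sinh y ≤ Real.sinh (a * y) := by
  have hderiv (t : ℝ) : HasDerivAt (fun t => Real.sinh (a * t) - a * Real.sinh t)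
      (Real.cosh (a * t) * (a * 1) - a * Real.cosh t) t :=
    ((hasDerivAt_id t).const_mul a).sinh.sub ((Real.hasDerivAt_sinh t).const_mul a)
  have hmono : MonotoneOn (fun t => Real.sinh (a * t) - a * Real.sinh t) (Set.Ici 0) := by
    refine monotoneOn_of_deriv_nonneg (convex_Ici 0)
      (fun t _ => (hderiv t).continuousAt.continuousWithinAt)
      (fun t _ => (hderiv t).differentiableAt.differentiableWithinAt) fun t ht => ?_
    rw [interior_Ici, Set.mem_Ioi] at ht
    have hcosh : Real.cosh t ≤ Real.cosh (a * t) := by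
      rw [Real.cosh_le_cosh, abs_of_pos ht, abs_of_pos (by positivity)]
      nlinarith
    rw [(hderiv t).deriv]
    nlinarith
  have h := hmono Set.self_mem_Ici hy hy
  simp only [mul_zero, Real.sinh_zero, sub_zero] at h
  linarith

/-- The inequality h₂(α, η) ≤ 0 from the bounded range zCDP analysis:
α(α−1)η + sinh(αη) ≤ coth(η/2)·(cosh(αη) − 1), where coth(x) = cosh(x)/sinh(x). -/
theorem br_h2_nonpos (α : ℝ) (hα : 1 < α) (η : ℝ) (hη : 0 < η) :
    α * (α - 1) * η + Real.sinh (α * η)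
      ≤ (Real.cosh (η / 2) / Real.sinh (η / 2)) * (Real.cosh (α * η) - 1) := by
  obtain ⟨y, rfl⟩ : ∃ y, η = 2 * y := ⟨η / 2, by ring⟩
  have hy : 0 < y := by linarith
  have hs : 0 < Real.sinh y := Real.sinh_pos_iff.2 hy
  have hd : 0 ≤ (α - 1) * y := mul_nonneg (by linarith) hy.le
  have hprod : (α * Real.sinh y) * ((α - 1) * y)
      ≤ Real.sinh (α * y) * Real.sinh ((α - 1) * y) :=
    mul_le_mul (Real.mul_sinh_le_sinh_mul hα.le hy.le) (Real.self_le_sinh_iff.2 hd) hd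
      (Real.sinh_nonneg_iff.2 (by positivity))
  rw [show (α - 1) * y = α * y - y by ring, Real.sinh_sub] at hprod
  rw [mul_div_cancel_left₀ y two_ne_zero, show α * (2 * y) = 2 * (α * y) by ring,
    Real.sinh_two_mul, Real.cosh_two_mul, Real.cosh_sq, div_mul_eq_mul_div, le_div_iff₀ hs]
  linarith
end

section
/- Define φ : [0, ∞) → ℝ by φ(x) = log(sinh(x)/x) for x > 0 and φ(0) = 0. Then φ is strictly convex on (0, ∞), and φ is superadditive on [0, ∞): for all x, y ≥ 0, φ(x + y) ≥ φ(x) + φ(y). (Equivalently, sinh(x+y)/(x+y) ≥ (sinh(x)/x)·(sinh(y)/y) for all x, y > 0.) -/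
/-- φ(x) = log(sinh(x)/x) for x > 0, with φ(0) = 0. -/
noncomputable def phi (x : ℝ) : ℝ := if x = 0 then 0 else Real.log (Real.sinh x / x)

theorem sinh_le_mul_cosh {x : ℝ} (hx : 0 ≤ x) : Real.sinh x ≤ x * Real.cosh x := by
  have hderiv (t : ℝ) : HasDerivAt (fun t ↦ t * Real.cosh t - Real.sinh t)
      (t * Real.sinh t) t :=
    (((hasDerivAt_id' t).mul (Real.hasDerivAt_cosh t)).sub (Real.hasDerivAt_sinh t)).congr_deriv
      (by ring)
  have hmono : MonotoneOn (fun t ↦ t * Real.cosh t - Real.sinh t) (Set.Ici 0) := by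
    refine monotoneOn_of_deriv_nonneg (convex_Ici 0)
      (fun t _ ↦ (hderiv t).continuousAt.continuousWithinAt)
      (fun t _ ↦ (hderiv t).differentiableAt.differentiableWithinAt) fun t ht ↦ ?_
    rw [interior_Ici] at ht
    rw [(hderiv t).deriv]
    exact mul_nonneg ht.le (Real.sinh_nonneg_iff.2 ht.le)
  simpa using hmono Set.self_mem_Ici hx hx

theorem phi_of_pos {x : ℝ} (hx : 0 < x) : phi x = Real.log (Real.sinh x / x) := if_neg hx.ne'

theorem hasDerivAt_phi {x : ℝ} (hx : 0 < x) :
    HasDerivAt phi (Real.cosh x / Real.sinh x - x⁻¹) x := by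
  have hs : 0 < Real.sinh x := Real.sinh_pos_iff.2 hx
  refine HasDerivAt.congr_of_eventuallyEq
    (f := fun t ↦ Real.log (Real.sinh t) - Real.log t)
    (((Real.hasDerivAt_sinh x).log hs.ne').sub (Real.hasDerivAt_log hx.ne')) ?_
  filter_upwards [Ioi_mem_nhds hx] with t ht
  rw [phi_of_pos ht, Real.log_div (Real.sinh_pos_iff.2 ht).ne' (ne_of_gt ht)]

theorem hasDerivAt_deriv_phi {x : ℝ} (hx : 0 < x) :
    HasDerivAt (deriv phi) ((x ^ 2)⁻¹ - (Real.sinh x ^ 2)⁻¹) x := by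
  have hs : 0 < Real.sinh x := Real.sinh_pos_iff.2 hx
  refine HasDerivAt.congr_of_eventuallyEq
    (f := fun t ↦ Real.cosh t / Real.sinh t - t⁻¹) ?_ ?_
  · refine (((Real.hasDerivAt_cosh x).div (Real.hasDerivAt_sinh x) hs.ne').sub
      (hasDerivAt_inv hx.ne')).congr_deriv ?_
    field_simp
    linear_combination -x ^ 2 * Real.cosh_sq x
  · filter_upwards [Ioi_mem_nhds hx] with t ht using (hasDerivAt_phi ht).deriv

theorem strictConvexOn_phi : StrictConvexOn ℝ (Set.Ioi 0) phi := by
  refine strictConvexOn_of_deriv2_pos' (convex_Ioi 0)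
    (fun x hx ↦ (hasDerivAt_phi hx).continuousAt.continuousWithinAt) fun x hx ↦ ?_
  rw [Set.mem_Ioi] at hx
  rw [Function.iterate_succ_apply, Function.iterate_one, (hasDerivAt_deriv_phi hx).deriv, sub_pos]
  have := Real.self_lt_sinh_iff.2 hx
  gcongr

theorem phi_add_le {x y : ℝ} (hx : 0 ≤ x) (hy : 0 ≤ y) : phi x + phi y ≤ phi (x + y) := by
  rcases hx.eq_or_lt with rfl | hx
  · simp [phi]
  rcases hy.eq_or_lt with rfl | hy
  · simp [phi]
  have hsx := Real.sinh_pos_iff.2 hx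
  have hsy := Real.sinh_pos_iff.2 hy
  rw [phi_of_pos hx, phi_of_pos hy, phi_of_pos (add_pos hx hy),
    ← Real.log_mul (by positivity) (by positivity)]
  refine Real.log_le_log (by positivity) ?_
  rw [div_mul_div_comm, div_le_div_iff₀ (by positivity) (by positivity), Real.sinh_add]
  have h₁ := mul_le_mul_of_nonneg_left (sinh_le_mul_cosh hy.le) (mul_pos hx hsx).le
  have h₂ := mul_le_mul_of_nonneg_left (sinh_le_mul_cosh hx.le) (mul_pos hy hsy).le
  linarith

/-- φ is strictly convex on (0, ∞) and superadditive on [0, ∞). -/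
theorem phi_strictConvex_and_superadditive :
    StrictConvexOn ℝ (Set.Ioi 0) phi ∧
      ∀ x y : ℝ, 0 ≤ x → 0 ≤ y → phi x + phi y ≤ phi (x + y) := by
  exact ⟨strictConvexOn_phi, fun _ _ ↦ phi_add_le⟩
end
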